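/- arXiv:1709.04042 — 2 statements merged into one kernel-verified Lean document; each statement's English description precedes it below -/
import Mathlib

section
/- Fix t ∈ (0,1/4), set k = 4t, and let ψ_k(z) = (1 − √(1−kz²))/(√k·z) for z ∈ 𝔻∖{0} (principal square root) extended analytically by ψ_k(0)=0. Then: (a) for all integers n,p ≥ 1, the Taylor coefficient [zⁿ]ψ_k(z)^p equals (k/4)^{n/2}·(p/n)·C(n,(n+p)/2) if n−p is a nonnegative even integer, and 0 otherwise; (b) for all l,p ≥ 1, the generating function J_{l,p}(t) := W^{(π/2,(−π/2,π/2))}_{l,p}(t) equals Σ_{n=1}^∞ (p/n)·C(n,(n+l)/2)·C(n,(n+p)/2)·tⁿ, the sum running over n with n−l and n−p nonnegative and even; and (c) for all l,p ≥ 1, l·J_{l,p}(t) = Σ_{n=1}^∞ n·[zⁿ]ψ_k(z)^l·[zⁿ]ψ_k(z)^p. -/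
open Complex Real Set

noncomputable section

/-- A lattice point `(x,y)` viewed as the complex number `x + iy`. -/
def ptC (p : ℤ × ℤ) : ℂ := (p.1 : ℂ) + (p.2 : ℂ) * Complex.I

/-- A diagonal step on `ℤ²`. -/
def IsDiagStep (a b : ℤ × ℤ) : Prop :=
  b - a = (1, 1) ∨ b - a = (1, -1) ∨ b - a = (-1, -1) ∨ b - a = (-1, 1)

/-- A rectilinear step on `ℤ²`. -/
def IsRectStep (a b : ℤ × ℤ) : Prop :=
  b - a = (1, 0) ∨ b - a = (-1, 0) ∨ b - a = (0, 1) ∨ b - a = (0, -1)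

/-- `w` encodes a simple diagonal walk `(w₀, …, w_n)` as a list of length `n+1`. -/
def IsWalkList (w : List (ℤ × ℤ)) : Prop := w ≠ [] ∧ w.Chain' IsDiagStep

/-- Winding angle of the walk `w` around the origin up to time `i`. -/
def windTo (w : List (ℤ × ℤ)) (i : ℕ) : ℝ :=
  ∑ j ∈ Finset.range i, (ptC (w.getD (j + 1) 0) / ptC (w.getD j 0)).arg

/-- The full winding angle of the walk `w` around the origin. -/
def wind (w : List (ℤ × ℤ)) : ℝ := windTo w (w.length - 1)

/-- The condition on walks counted by `W^{(α,I)}_{l,p}`: a simple diagonal walk on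
`ℤ² ∖ {0}` from `(p,0)` to a point on one of the axes at distance `l` from the origin,
with full winding angle `α` and intermediate winding angles in `I`. -/
def WCond (l p : ℕ) (α : ℝ) (I : Set ℝ) (w : List (ℤ × ℤ)) : Prop :=
  IsWalkList w ∧ (∀ x ∈ w, x ≠ (0, 0)) ∧ w.head? = some ((p : ℤ), 0) ∧
    (w.getLast? = some ((l : ℤ), 0) ∨ w.getLast? = some (-(l : ℤ), 0) ∨
      w.getLast? = some (0, (l : ℤ)) ∨ w.getLast? = some (0, -(l : ℤ))) ∧
    wind w = α ∧ (∀ i, 1 ≤ i → i ≤ w.length - 2 → windTo w i ∈ I)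

/-- The generating function `W^{(α,I)}_{l,p}(t)`. -/
def Wgen (t : ℝ) (l p : ℕ) (α : ℝ) (I : Set ℝ) : ℝ :=
  ∑' w : {w : List (ℤ × ℤ) // WCond l p α I w}, t ^ (w.val.length - 1)

/-- The complete elliptic integral of the first kind `K(k)`. -/
def Kell (k : ℝ) : ℝ := ∫ y in (0:ℝ)..1, 1 / Real.sqrt ((1 - y ^ 2) * (1 - k ^ 2 * y ^ 2))

/-- The complete elliptic integral of the second kind `E(k)`. -/
def Eell (k : ℝ) : ℝ := ∫ y in (0:ℝ)..1, Real.sqrt (1 - k ^ 2 * y ^ 2) / Real.sqrt (1 - y ^ 2)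

/-- The complementary modulus `k' = √(1-k²)`. -/
def kComp (k : ℝ) : ℝ := Real.sqrt (1 - k ^ 2)

/-- The elliptic nome `q_k = exp(-π K(k')/K(k))`. -/
def qNome (k : ℝ) : ℝ := Real.exp (-π * Kell (kComp k) / Kell k)

/-- The descending Landen transformation `k₁ = (1-k')/(1+k')`. -/
def kLanden (k : ℝ) : ℝ := (1 - kComp k) / (1 + kComp k)

/-- `T_k = K(k')/(4K(k))`. -/
def Tell (k : ℝ) : ℝ := Kell (kComp k) / (4 * Kell k)

/-- The plane minus the two real slits `{z ∈ ℝ : z² ≥ κ}`. -/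
def slitDom (κ : ℝ) : Set ℂ := {z : ℂ | ¬(z.im = 0 ∧ κ ≤ z.re ^ 2)}

/-- `v` is the analytic function `v_κ` on `ℂ ∖ {z ∈ ℝ : z² ≥ κ}` with `v 0 = 0` and
`v'(z) = 1/(4K(κ)√((κ-z²)(1-κz²)))`, the branch of the square root being positive on
`(-√κ, √κ)` (by analytic continuation this determines `v` uniquely). -/
structure IsVmap (κ : ℝ) (v : ℂ → ℂ) : Prop where
  map_zero : v 0 = 0
  analytic : AnalyticOnNhd ℂ v (slitDom κ)
  deriv_real : ∀ x : ℝ, x ^ 2 < κ →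
    HasDerivAt v ((1 / (4 * Kell κ * Real.sqrt ((κ - x ^ 2) * (1 - κ * x ^ 2))) : ℝ) : ℂ)
      (x : ℂ)

/-- The function `f_m(z) = cos(2πm(v(z) + 1/4)) - cos(πm/2)` built from `v = v_{k₁}`. -/
def fmFun (v : ℂ → ℂ) (m : ℕ) (z : ℂ) : ℂ :=
  Complex.cos (2 * (π : ℂ) * m * (v z + 1 / 4)) - Complex.cos ((π : ℂ) * m / 2)

/-- `a n m` is the (real) Taylor coefficient `[zⁿ] f_m(z)` at `0`. -/
def IsCoeff (κ : ℝ) (v : ℂ → ℂ) (a : ℕ → ℕ → ℝ) : Prop :=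
  ∀ m : ℕ, 1 ≤ m → ∀ z : ℂ, z ∈ slitDom κ → ‖z‖ < 1 →
    HasSum (fun n : ℕ => (a n m : ℂ) * z ^ n) (fmFun v m z)

/-- An excursion: a nonempty simple diagonal walk from the origin to the origin with no
intermediate visits to the origin. -/
def IsExcursion (w : List (ℤ × ℤ)) : Prop :=
  2 ≤ w.length ∧ w.Chain' IsDiagStep ∧ w.head? = some (0, 0) ∧ w.getLast? = some (0, 0) ∧
    ∀ i, 1 ≤ i → i ≤ w.length - 2 → w.getD i 0 ≠ (0, 0)

/-- The winding angle sequence of an excursion: `θ₀ = θ₁ = 0`, increments of the first and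
last step do not contribute, and `θ_n = θ_{n-1}`. -/
def windExcTo (w : List (ℤ × ℤ)) (i : ℕ) : ℝ :=
  ∑ j ∈ Finset.Icc 2 (min i (w.length - 2)), (ptC (w.getD j 0) / ptC (w.getD (j - 1) 0)).arg

/-- The full winding angle of an excursion. -/
def windExc (w : List (ℤ × ℤ)) : ℝ := windExcTo w (w.length - 1)

/-- `F^{(α)}(t)`: generating function of excursions with winding angle `α`. -/
def Fgen (t α : ℝ) : ℝ :=
  ∑' w : {w : List (ℤ × ℤ) // IsExcursion w ∧ windExc w = α}, t ^ (w.val.length - 1)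

/-- `F(t,b) = Σ_w t^{|w|} e^{i b θ^w}`, the characteristic function of excursions. -/
def Fchar (t b : ℝ) : ℂ :=
  ∑' w : {w : List (ℤ × ℤ) // IsExcursion w},
    (t : ℂ) ^ (w.val.length - 1) * Complex.exp (Complex.I * b * windExc w.val)

/-- `ψ_k(z) = (1 - √(1-kz²))/(√k z)` (principal square root), `ψ_k(0) = 0`. -/
def psiK (k : ℝ) (z : ℂ) : ℂ :=
  if z = 0 then 0 else (1 - (1 - (k : ℂ) * z ^ 2) ^ ((1 : ℂ) / 2)) / ((Real.sqrt k : ℂ) * z)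

/-- The number of `±1` walks of length `n` from `0` to `d`. -/
def lineCount : ℕ → ℤ → ℤ
  | 0, d => if d = 0 then 1 else 0
  | n + 1, d => lineCount n (d - 1) + lineCount n (d + 1)

/-- The number of `±1` walks of length `n` from `x` that visit `(-∞, 0]` only at their last
point, which is `0`. -/
def passageCount : ℕ → ℤ → ℤ
  | 0, x => if x = 0 then 1 else 0
  | n + 1, x => if 0 < x then passageCount n (x - 1) + passageCount n (x + 1) else 0

lemma lineCount_of_lt (n : ℕ) : ∀ d : ℤ, d < -n → lineCount n d = 0 := by
  induction n with
  | zero => intro d hd; simp only [lineCount]; rw [if_neg]; simp at hd; omega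
  | succ n ih =>
    intro d hd
    push_cast at hd
    rw [lineCount, ih _ (by omega), ih _ (by omega), add_zero]

lemma lineCount_of_odd (n : ℕ) : ∀ d : ℤ, ¬ Even (n + d) → lineCount n d = 0 := by
  induction n with
  | zero =>
    intro d hd
    simp only [lineCount]
    rw [if_neg]
    rintro rfl
    simp at hd
  | succ n ih =>
    intro d hd
    rw [lineCount, ih, ih, add_zero] <;> (push_cast at hd; grind)

lemma lineCount_eq_choose (n : ℕ) : ∀ j : ℕ, lineCount n (2 * j - n) = n.choose j := by
  induction n with
  | zero => rintro (_ | j) <;> simp [lineCount]; omega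
  | succ n ih =>
    rintro (_ | j)
    · have h := ih 0
      rw [lineCount, lineCount_of_lt n _ (by push_cast; omega)]
      simp only [CharP.cast_eq_zero, mul_zero, Nat.cast_add, Nat.cast_one] at h ⊢
      rw [show ((0 : ℤ) - (n + 1) + 1) = 0 - n by ring, h]
      simp
    · have h0 := ih j
      have h1 := ih (j + 1)
      rw [lineCount]
      push_cast at h1 ⊢
      rw [show (2 * ((j : ℤ) + 1) - (n + 1) - 1) = 2 * j - n by ring, h0,
        show (2 * ((j : ℤ) + 1) - (n + 1) + 1) = 2 * (j + 1) - n by ring, h1,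
        Nat.choose_succ_succ]
      push_cast
      ring

lemma lineCount_natCast (n d : ℕ) :
    lineCount n d = if d ≤ n ∧ Even (n + d) then (n.choose ((n + d) / 2) : ℤ) else 0 := by
  by_cases he : Even (n + d)
  · obtain ⟨j, hj⟩ := he
    have h := lineCount_eq_choose n j
    rw [show (2 * (j : ℤ) - n) = d by omega] at h
    rw [h, show (n + d) / 2 = j by omega]
    split_ifs with hc
    · rfl
    · have : n < j := by
        have : ¬ d ≤ n := fun h' => hc ⟨h', j, hj⟩
        omega
      simp [Nat.choose_eq_zero_of_lt this]
  · rw [if_neg (fun h => he h.2), lineCount_of_odd]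
    exact_mod_cast he

/-- The reflection principle. -/
lemma passageCount_succ (n : ℕ) :
    ∀ x : ℤ, 0 ≤ x → passageCount (n + 1) x = lineCount n (x - 1) - lineCount n (x + 1) := by
  induction n with
  | zero =>
    intro x hx
    simp only [passageCount, lineCount]
    split_ifs <;> omega
  | succ n ih =>
    intro x hx
    rw [passageCount]
    split_ifs with h
    · rw [ih _ (by omega), ih _ (by omega)]
      simp only [lineCount]
      ring_nf
    · obtain rfl : x = 0 := by omega
      have key : ∀ m : ℕ, ∀ d : ℤ, lineCount m (-d) = lineCount m d := by
        intro m
        induction m with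
        | zero => intro d; simp [lineCount]
        | succ m ihm =>
          intro d
          rw [lineCount, lineCount, add_comm, ← ihm (d - 1), ← ihm (d + 1)]
          ring_nf
      rw [zero_sub, zero_add, key, sub_self]

lemma mul_passageCount (n p : ℕ) (hp : 1 ≤ p) :
    (n : ℤ) * passageCount n p =
      if p ≤ n ∧ Even (n + p) then (p : ℤ) * n.choose ((n + p) / 2) else 0 := by
  rcases n with _ | n
  · rw [if_neg (by omega)]; simp
  · have hl := lineCount_natCast (n + 1) p
    by_cases he : Even (n + 1 + p)
    · obtain ⟨j, hj⟩ := he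
      obtain ⟨i, rfl⟩ : ∃ i, j = i + 1 := ⟨j - 1, by omega⟩
      have h0 := lineCount_eq_choose n i
      have h1 := lineCount_eq_choose n (i + 1)
      have h2 := lineCount_eq_choose (n + 1) (i + 1)
      rw [passageCount_succ _ _ (by omega), show (p : ℤ) - 1 = 2 * i - n by omega, h0,
        show (p : ℤ) + 1 = 2 * (i + 1 : ℕ) - n by omega, h1]
      have hr : (if p ≤ n + 1 ∧ Even (n + 1 + p) then
          (p : ℤ) * (n + 1).choose ((n + 1 + p) / 2) else 0) = p * (n + 1).choose (i + 1) := by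
        rw [show (2 * ((i + 1 : ℕ) : ℤ) - (n + 1 : ℕ)) = p by omega, hl] at h2
        rw [← h2, mul_ite, mul_zero]
      rw [hr]
      have e1 : ((n : ℤ) + 1) * n.choose i = (n + 1).choose (i + 1) * (i + 1) := by
        exact_mod_cast Nat.add_one_mul_choose_eq n i
      have e2 : ((n + 1).choose (i + 1) : ℤ) = n.choose i + n.choose (i + 1) := by
        exact_mod_cast Nat.choose_succ_succ n i
      have e3 : (p : ℤ) = 2 * i + 1 - n := by omega
      rw [e3]
      push_cast
      linear_combination 2 * e1 + ((n : ℤ) + 1) * e2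
    · rw [if_neg (fun h => he h.2), passageCount_succ _ _ (by omega), lineCount_of_odd,
        lineCount_of_odd]
      · simp
      all_goals
        intro h
        apply he
        have : Even ((n : ℤ) + 1 + p) := by grind
        exact_mod_cast this

lemma lineCount_nonneg (n : ℕ) : ∀ d, 0 ≤ lineCount n d := by
  induction n with
  | zero => intro d; simp only [lineCount]; split_ifs <;> simp
  | succ n ih => intro d; exact add_nonneg (ih _) (ih _)

lemma lineCount_le (n : ℕ) : ∀ d, lineCount n d ≤ 2 ^ n := by
  induction n with
  | zero => intro d; simp only [lineCount]; split_ifs <;> simp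
  | succ n ih => intro d; rw [lineCount, pow_succ]; linarith [ih (d - 1), ih (d + 1)]

lemma passageCount_nonneg (n : ℕ) : ∀ x, 0 ≤ passageCount n x := by
  induction n with
  | zero => intro x; simp only [passageCount]; split_ifs <;> simp
  | succ n ih =>
    intro x
    rw [passageCount]
    split_ifs
    · exact add_nonneg (ih _) (ih _)
    · rfl

lemma passageCount_le (n : ℕ) : ∀ x, passageCount n x ≤ 2 ^ n := by
  induction n with
  | zero => intro x; simp only [passageCount]; split_ifs <;> simp
  | succ n ih =>
    intro x
    rw [passageCount, pow_succ]
    split_ifs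
    · linarith [ih (x - 1), ih (x + 1)]
    · positivity

lemma coeff_unique {a b : ℕ → ℂ} {f : ℂ → ℂ}
    (ha : ∀ᶠ z in nhds 0, HasSum (fun n => a n * z ^ n) (f z))
    (hb : ∀ᶠ z in nhds 0, HasSum (fun n => b n * z ^ n) (f z)) : a = b := by
  have key : ∀ c : ℕ → ℂ, (∀ᶠ z in nhds 0, HasSum (fun n => c n * z ^ n) (f z)) →
      HasFPowerSeriesAt f (FormalMultilinearSeries.ofScalars ℂ c) 0 := by
    intro c hc
    rw [hasFPowerSeriesAt_iff]
    filter_upwards [hc] with z hz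
    simpa [FormalMultilinearSeries.coeff_ofScalars, mul_comm] using hz
  have h := (key a ha).eq_formalMultilinearSeries (key b hb)
  ext n
  simpa [FormalMultilinearSeries.coeff_ofScalars] using
    congrArg (fun p => FormalMultilinearSeries.coeff p n) h

lemma psiK_quadratic {k : ℝ} (hk : 0 < k) (z : ℂ) :
    (Real.sqrt k : ℂ) * z * (psiK k z ^ 2 + 1) = 2 * psiK k z := by
  have hs : (Real.sqrt k : ℂ) ≠ 0 := by
    exact_mod_cast (Real.sqrt_pos.2 hk).ne'
  have hs2 : (Real.sqrt k : ℂ) ^ 2 = k := by exact_mod_cast Real.sq_sqrt hk.le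
  rcases eq_or_ne z 0 with rfl | hz
  · simp [psiK]
  · have h := Complex.cpow_nat_inv_pow (1 - (k : ℂ) * z ^ 2) (two_ne_zero)
    rw [psiK, if_neg hz, one_div]
    push_cast at h
    set s := (1 - (k : ℂ) * z ^ 2) ^ ((2 : ℂ)⁻¹)
    field_simp
    linear_combination z ^ 2 * hs2 + h

lemma psiK_analyticAt {k : ℝ} (hk : 0 < k) : AnalyticAt ℂ (psiK k) 0 := by
  have hs : (Real.sqrt k : ℂ) ≠ 0 := by
    exact_mod_cast (Real.sqrt_pos.2 hk).ne'
  have hs2 : (Real.sqrt k : ℂ) ^ 2 = k := by exact_mod_cast Real.sq_sqrt hk.le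
  have ha : AnalyticAt ℂ (fun z : ℂ => (1 - (k : ℂ) * z ^ 2) ^ ((1 : ℂ) / 2)) 0 := by
    apply AnalyticAt.cpow
    · fun_prop
    · fun_prop
    · simp
  have h1 : AnalyticAt ℂ (fun z : ℂ => 1 + (1 - (k : ℂ) * z ^ 2) ^ ((1 : ℂ) / 2)) 0 := by
    fun_prop
  have hne : ∀ᶠ z in nhds (0 : ℂ), 1 + (1 - (k : ℂ) * z ^ 2) ^ ((1 : ℂ) / 2) ≠ 0 :=
    h1.continuousAt.eventually_ne (by norm_num)
  have h2 : AnalyticAt ℂ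
      (fun z : ℂ => (Real.sqrt k : ℂ) * z / (1 + (1 - (k : ℂ) * z ^ 2) ^ ((1 : ℂ) / 2))) 0 := by
    apply AnalyticAt.div
    · fun_prop
    · exact h1
    · norm_num
  refine h2.congr ?_
  filter_upwards [hne] with z hz
  rw [psiK]
  split_ifs with h0
  · simp [h0]
  · have h := Complex.cpow_nat_inv_pow (1 - (k : ℂ) * z ^ 2) (two_ne_zero)
    push_cast at h
    rw [← one_div] at h
    set s := (1 - (k : ℂ) * z ^ 2) ^ ((1 : ℂ) / 2)
    field_simp
    linear_combination h + z ^ 2 * hs2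

/-- The Taylor coefficients of the powers of `ψ_k`. -/
lemma psiK_pow_coeff {k : ℝ} (hk : 0 < k) (p : ℕ) (c : ℕ → ℂ)
    (hc : ∀ᶠ z in nhds 0, HasSum (fun n => c n * z ^ n) (psiK k z ^ p)) (n : ℕ) :
    c n = ((Real.sqrt k : ℂ) / 2) ^ n * passageCount n p := by
  have hex : ∀ q : ℕ, ∃ a : ℕ → ℂ,
      ∀ᶠ z in nhds 0, HasSum (fun n => a n * z ^ n) (psiK k z ^ q) := by
    intro q
    obtain ⟨s, hs⟩ := (psiK_analyticAt hk).pow q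
    refine ⟨s.coeff, ?_⟩
    rw [hasFPowerSeriesAt_iff] at hs
    filter_upwards [hs] with z hz
    simpa [mul_comm] using hz
  choose u hu using hex
  have h0 : u 0 = fun n => if n = 0 then 1 else 0 := by
    refine coeff_unique (hu 0) (Filter.Eventually.of_forall fun z => ?_)
    rw [pow_zero]
    convert hasSum_ite_eq 0 (1 : ℂ) using 1
    ext n
    rcases n with _ | n <;> simp
  have hzero : ∀ q, u (q + 1) 0 = 0 := by
    intro q
    have h := (hu (q + 1)).self_of_nhds
    have h' := hasSum_single (f := fun n => u (q + 1) n * (0 : ℂ) ^ n) 0 (by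
      intro n hn; simp [hn])
    simpa [psiK] using h'.unique h
  have hrec : ∀ q n, 2 * u (q + 1) (n + 1) = Real.sqrt k * (u q n + u (q + 2) n) := by
    intro q n
    have h1 : ∀ᶠ z in nhds (0 : ℂ), HasSum (fun n => 2 * u (q + 1) n * z ^ n)
        (2 * psiK k z ^ (q + 1)) := by
      filter_upwards [hu (q + 1)] with z hz
      simpa [mul_assoc] using hz.mul_left 2
    have h2 : ∀ᶠ z in nhds (0 : ℂ), HasSum
        (fun n => (if n = 0 then 0 else Real.sqrt k * (u q (n - 1) + u (q + 2) (n - 1))) * z ^ n)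
        (2 * psiK k z ^ (q + 1)) := by
      filter_upwards [hu q, hu (q + 2)] with z hz hz2
      rw [← hasSum_nat_add_iff' 1]
      convert (hz.add hz2).mul_left (Real.sqrt k * z) using 1
      · rfl
      · ext m
        simp
        ring
      · rw [Finset.sum_range_one, if_pos rfl, zero_mul, sub_zero]
        linear_combination -psiK k z ^ q * psiK_quadratic hk z
    simpa using congrFun (coeff_unique h1 h2) (n + 1)
  have main : ∀ n q : ℕ, u q n = ((Real.sqrt k : ℂ) / 2) ^ n * passageCount n q := by
    intro n
    induction n with
    | zero =>
      rintro (_ | q)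
      · simp [h0, passageCount]
      · rw [hzero, passageCount, if_neg (by omega)]
        simp
    | succ n ih =>
      rintro (_ | q)
      · simp [h0, passageCount]
      · have h := hrec q n
        rw [ih, ih] at h
        rw [passageCount, if_pos (by omega)]
        push_cast at h ⊢
        rw [show (q : ℤ) + 1 - 1 = q by ring, show (q : ℤ) + 1 + 1 = q + 2 by ring]
        rw [pow_succ]
        linear_combination h / 2
  rw [coeff_unique hc (hu p), main]

lemma arg_div_eq_sub {a b : ℂ} (ha : 0 < a.re) (hb : 0 ≤ b.re) (hb0 : b ≠ 0) :
    (b / a).arg = b.arg - a.arg := by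
  have h1 := Complex.abs_arg_lt_pi_div_two_iff.2 (Or.inl ha)
  have h2 := Complex.abs_arg_le_pi_div_two_iff.2 hb
  have ha0 : a ≠ 0 := by rintro rfl; simp at ha
  rw [abs_lt] at h1
  rw [abs_le] at h2
  have hinv : (a⁻¹).arg = -a.arg := by
    rw [Complex.arg_inv, if_neg]
    linarith [Real.pi_pos]
  rw [div_eq_mul_inv, Complex.arg_mul hb0 (inv_ne_zero ha0), hinv, sub_eq_add_neg]
  rw [hinv]
  constructor <;> linarith [Real.pi_pos]

lemma ptC_re (a : ℤ × ℤ) : (ptC a).re = a.1 := by simp [ptC]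

lemma ptC_im (a : ℤ × ℤ) : (ptC a).im = a.2 := by simp [ptC]

lemma ptC_ne_zero {a : ℤ × ℤ} (h : a ≠ (0, 0)) : ptC a ≠ 0 := by
  intro h0
  apply h
  have h1 := congrArg Complex.re h0
  have h2 := congrArg Complex.im h0
  rw [ptC_re, Complex.zero_re] at h1
  rw [ptC_im, Complex.zero_im] at h2
  exact Prod.ext (by exact_mod_cast h1) (by exact_mod_cast h2)

/-- In the closed right half-plane, the winding angle is the argument of the current point. -/
lemma windTo_eq_arg (w : List (ℤ × ℤ)) {p : ℕ}
    (h0 : w.getD 0 0 = ((p : ℤ), 0)) : ∀ i : ℕ, (∀ j < i, 0 < (w.getD j 0).1) →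
      0 ≤ (w.getD i 0).1 → w.getD i 0 ≠ (0, 0) → windTo w i = (ptC (w.getD i 0)).arg := by
  intro i
  induction i with
  | zero =>
    intro _ _ _
    rw [h0]
    simp only [windTo, Finset.range_zero, Finset.sum_empty, ptC]
    simp
  | succ i ih =>
    intro hpos hx hne
    have hi := hpos i (Nat.lt_succ_self i)
    have hi0 : w.getD i 0 ≠ (0, 0) := by
      intro h; rw [h] at hi; exact lt_irrefl _ hi
    have h := ih (fun j hj => hpos j (by omega)) hi.le hi0
    rw [windTo, Finset.sum_range_succ, ← windTo, h, arg_div_eq_sub _ _ (ptC_ne_zero hne)]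
    · ring
    · rw [ptC_re]; exact_mod_cast hi
    · rw [ptC_re]; exact_mod_cast hx

/-- Walks of length `n` from `a` to `(0, l)` all of whose points except the last have positive
abscissa. -/
structure IsPassage (l : ℤ) (n : ℕ) (a : ℤ × ℤ) (w : List (ℤ × ℤ)) : Prop where
  length : w.length = n + 1
  chain : w.IsChain IsDiagStep
  head : w.head? = some a
  last : w.getLast? = some (0, l)
  pos : ∀ i < n, 0 < (w.getD i 0).1

lemma getD_isDiagStep {w : List (ℤ × ℤ)} (h : w.IsChain IsDiagStep) {i : ℕ}
    (hi : i + 1 < w.length) : IsDiagStep (w.getD i 0) (w.getD (i + 1) 0) := by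
  rw [List.isChain_iff_getElem] at h
  have := h i hi
  rwa [List.getD_eq_getElem _ _ hi, List.getD_eq_getElem _ _ (Nat.lt_of_succ_lt hi)]

lemma IsDiagStep.fst_le {a b : ℤ × ℤ} (h : IsDiagStep a b) : a.1 - 1 ≤ b.1 := by
  rcases h with h | h | h | h <;>
  · have := congrArg Prod.fst h
    simp at this
    omega

lemma wCond_iff_isPassage {l p : ℕ} (hl : 1 ≤ l) (hp : 1 ≤ p) (w : List (ℤ × ℤ)) :
    WCond l p (π / 2) (Set.Ioo (-(π / 2)) (π / 2)) w ↔
      ∃ n, IsPassage l n ((p : ℤ), 0) w := by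
  have hpi := Real.pi_pos
  constructor
  · rintro ⟨⟨hne, hch⟩, hnz, hhead, hlast, hwind, hI⟩
    obtain ⟨n, hn⟩ : ∃ n, w.length = n + 1 :=
      ⟨w.length - 1, by have := List.length_pos_iff.2 hne; omega⟩
    have hch' : w.IsChain IsDiagStep := hch
    have hnz' : ∀ i ≤ n, w.getD i 0 ≠ (0, 0) := by
      intro i hi
      rw [List.getD_eq_getElem _ _ (by omega)]
      exact hnz _ (List.getElem_mem _)
    have h0 : w.getD 0 0 = ((p : ℤ), 0) := by
      rw [List.head?_eq_getElem?] at hhead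
      simp [List.getD_eq_getElem?_getD, hhead]
    have hlast' : w.getLast? = some (w.getD n 0) := by
      rw [List.getLast?_eq_getElem?, hn, List.getD_eq_getElem _ _ (by omega)]
      simp [hn]
    rw [wind, hn, Nat.add_sub_cancel] at hwind
    have hnpos : 0 < n := by
      rcases n with _ | n
      · simp [windTo] at hwind; linarith
      · omega
    have hstep : ∀ i, i < n → 0 < (w.getD i 0).1 → 0 ≤ (w.getD (i + 1) 0).1 := by
      intro i hi hx
      have := (getD_isDiagStep hch' (i := i) (by omega)).fst_le
      omega
    have hpos : ∀ i < n, ∀ j ≤ i, 0 < (w.getD j 0).1 := by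
      intro i
      induction i with
      | zero =>
        intro _ j hj
        obtain rfl : j = 0 := by omega
        rw [h0]; simp; omega
      | succ i ih =>
        intro hi j hj
        have hprev := ih (by omega)
        rcases Nat.lt_or_ge j (i + 1) with hji | hji
        · exact hprev j (by omega)
        · obtain rfl : j = i + 1 := by omega
          have hx := hstep i (by omega) (hprev i le_rfl)
          have hw := windTo_eq_arg w h0 (i + 1) (fun j hj => hprev j (by omega)) hx
            (hnz' _ (by omega))
          have hmem := hI (i + 1) (by omega) (by omega)
          rw [hw, Set.mem_Ioo, ← abs_lt, Complex.abs_arg_lt_pi_div_two_iff, ptC_re] at hmem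
          rcases hmem with h | h
          · exact_mod_cast h
          · exact absurd h (ptC_ne_zero (hnz' _ (by omega)))
    have hpos' : ∀ i < n, 0 < (w.getD i 0).1 := fun i hi => hpos i hi i le_rfl
    refine ⟨n, hn, hch', hhead, ?_, hpos'⟩
    have hxn : 0 ≤ (w.getD n 0).1 := by
      have := hstep (n - 1) (by omega) (hpos' _ (by omega))
      rwa [Nat.sub_add_cancel hnpos] at this
    rw [windTo_eq_arg w h0 n hpos' hxn (hnz' n le_rfl), Complex.arg_eq_pi_div_two_iff,
      ptC_re, ptC_im] at hwind
    obtain ⟨hre, him⟩ := hwind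
    rw [hlast'] at hlast ⊢
    have hre' : (w.getD n 0).1 = 0 := by exact_mod_cast hre
    have him' : 0 < (w.getD n 0).2 := by exact_mod_cast him
    have hl' : (w.getD n 0).2 = l := by
      simp only [Option.some_inj, Prod.ext_iff] at hlast
      omega
    rw [Option.some_inj]
    exact Prod.ext hre' hl'
  · rintro ⟨n, hn, hch, hhead, hlast, hpos⟩
    have h0 : w.getD 0 0 = ((p : ℤ), 0) := by
      rw [List.head?_eq_getElem?] at hhead
      simp [List.getD_eq_getElem?_getD, hhead]
    have hwn : w.getD n 0 = (0, (l : ℤ)) := by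
      rw [List.getLast?_eq_getElem?, hn, Nat.add_sub_cancel] at hlast
      simp [List.getD_eq_getElem?_getD, hlast]
    have hl0 : ((0 : ℤ), (l : ℤ)) ≠ (0, 0) := by
      intro h
      simp at h
      omega
    refine ⟨⟨?_, hch⟩, ?_, hhead, Or.inr (Or.inr (Or.inl hlast)), ?_, ?_⟩
    · rintro rfl; simp at hn
    · intro x hx
      obtain ⟨i, hi, rfl⟩ := List.getElem_of_mem hx
      rw [← List.getD_eq_getElem _ 0 hi]
      rcases Nat.lt_or_ge i n with h | h
      · have := hpos i h
        intro hz
        rw [hz] at this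
        exact lt_irrefl _ this
      · obtain rfl : i = n := by omega
        rwa [hwn]
    · rw [wind, hn, Nat.add_sub_cancel, windTo_eq_arg w h0 n hpos (by rw [hwn])
        (by rwa [hwn]), hwn, Complex.arg_eq_pi_div_two_iff, ptC_re, ptC_im]
      simp
      omega
    · intro i h1 h2
      have hi := hpos i (by omega)
      rw [windTo_eq_arg w h0 i (fun j hj => hpos j (by omega)) hi.le
        (by intro hz; rw [hz] at hi; exact lt_irrefl _ hi), Set.mem_Ioo, ← abs_lt,
        Complex.abs_arg_lt_pi_div_two_iff, ptC_re]
      left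
      exact_mod_cast hi

/-- The four diagonal steps. -/
def diagSteps : Finset (ℤ × ℤ) := {(1, 1), (1, -1), (-1, -1), (-1, 1)}

/-- The finite set of walks satisfying `IsPassage`. -/
def passages (l : ℤ) : ℕ → ℤ × ℤ → Finset (List (ℤ × ℤ))
  | 0, a => if a = (0, l) then {[a]} else ∅
  | n + 1, a =>
    if 0 < a.1 then
      (diagSteps.biUnion fun s => passages l n (a + s)).map ⟨List.cons a, List.cons_injective⟩
    else ∅

lemma mem_passages (l : ℤ) (n : ℕ) :
    ∀ a w, w ∈ passages l n a ↔ IsPassage l n a w := by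
  induction n with
  | zero =>
    intro a w
    rw [passages]
    constructor
    · intro h
      split_ifs at h with ha
      · rw [Finset.mem_singleton] at h
        subst h
        exact ⟨rfl, List.isChain_singleton _, rfl, by simp [ha], by simp⟩
      · simp at h
    · rintro ⟨hn, -, hhead, hlast, -⟩
      obtain ⟨b, rfl⟩ := List.length_eq_one_iff.1 hn
      simp only [List.head?_cons, List.getLast?_singleton, Option.some_inj] at hhead hlast
      subst hhead
      simp [hlast]
  | succ n ih =>
    intro a w
    rw [passages]
    constructor
    · intro h
      split_ifs at h with ha
      · rw [Finset.mem_map] at h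
        obtain ⟨v, hv, rfl⟩ := h
        rw [Finset.mem_biUnion] at hv
        obtain ⟨s, hs, hv⟩ := hv
        obtain ⟨hn, hch, hhead, hlast, hpos⟩ := (ih _ _).1 hv
        rcases v with _ | ⟨c, v⟩
        · simp at hn
        simp only [List.head?_cons, Option.some_inj] at hhead
        subst hhead
        refine ⟨by simpa using hn, ?_, rfl, ?_, ?_⟩
        · refine List.isChain_cons_cons.2 ⟨?_, hch⟩
          simpa [IsDiagStep, diagSteps] using hs
        · simpa [List.getLast?_cons_cons] using hlast
        · rintro (_ | i) hi
          · simpa using ha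
          · simpa using hpos i (by omega)
      · simp at h
    · rintro ⟨hn, hch, hhead, hlast, hpos⟩
      rcases w with _ | ⟨b, _ | ⟨c, v⟩⟩
      · simp at hn
      · simp at hn
      simp only [List.head?_cons, Option.some_inj] at hhead
      subst hhead
      rw [if_pos (by simpa using hpos 0 (by omega)), Finset.mem_map]
      rw [List.isChain_cons_cons] at hch
      refine ⟨c :: v, ?_, rfl⟩
      rw [Finset.mem_biUnion]
      refine ⟨c - b, by simpa [IsDiagStep, diagSteps] using hch.1, ?_⟩
      rw [ih]
      refine ⟨by simpa using hn, hch.2, by simp, ?_, ?_⟩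
      · simpa [List.getLast?_cons_cons] using hlast
      · intro i hi
        simpa using hpos (i + 1) (by omega)

lemma card_passages (l : ℤ) (n : ℕ) :
    ∀ a : ℤ × ℤ, ((passages l n a).card : ℤ) = passageCount n a.1 * lineCount n (l - a.2) := by
  induction n with
  | zero =>
    rintro ⟨x, y⟩
    simp only [passages, passageCount, lineCount, Prod.mk.injEq, sub_eq_zero]
    by_cases hx : x = 0 <;> by_cases hy : l = y <;> simp [hx, hy, eq_comm]
  | succ n ih =>
    rintro ⟨x, y⟩
    rw [passages, passageCount, lineCount]
    split_ifs with h
    · rw [Finset.card_map, Finset.card_biUnion]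
      · push_cast
        simp only [ih, diagSteps]
        rw [Finset.sum_insert (by decide), Finset.sum_insert (by decide),
          Finset.sum_insert (by decide), Finset.sum_singleton]
        simp only [Prod.mk_add_mk]
        ring_nf
      · intro s _ s' _ hss
        rw [Function.onFun, Finset.disjoint_left]
        intro w hw hw'
        apply hss
        have h1 := ((mem_passages _ _ _ _).1 hw).head
        rw [((mem_passages _ _ _ _).1 hw').head, Option.some_inj] at h1
        exact (add_left_cancel h1).symm
    · simp

lemma Wgen_eq_tsum {t : ℝ} (ht : t ∈ Set.Ioo (0 : ℝ) (1 / 4)) {l p : ℕ} (hl : 1 ≤ l)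
    (hp : 1 ≤ p) :
    Wgen t l p (π / 2) (Set.Ioo (-(π / 2)) (π / 2)) =
      ∑' n : ℕ, (passageCount n p : ℝ) * lineCount n l * t ^ n := by
  have hiff := wCond_iff_isPassage hl hp
  let g : (Σ n : ℕ, {w // w ∈ passages l n ((p : ℤ), 0)}) →
      {w : List (ℤ × ℤ) // WCond l p (π / 2) (Set.Ioo (-(π / 2)) (π / 2)) w} :=
    fun x => ⟨x.2.1, (hiff _).2 ⟨x.1, (mem_passages _ _ _ _).1 x.2.2⟩⟩
  have hlen : ∀ x, (g x).1.length - 1 = x.1 := by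
    rintro ⟨n, w, hw⟩
    simp [g, ((mem_passages _ _ _ _).1 hw).length]
  have hg : Function.Bijective g := by
    constructor
    · intro x y hxy
      have h1 : x.1 = y.1 := by rw [← hlen x, ← hlen y, hxy]
      obtain ⟨n, w, hw⟩ := x
      obtain ⟨m, v, hv⟩ := y
      obtain rfl : n = m := h1
      have h2 : w = v := congrArg Subtype.val hxy
      subst h2
      rfl
    · rintro ⟨w, hw⟩
      obtain ⟨n, hn⟩ := (hiff w).1 hw
      exact ⟨⟨n, w, (mem_passages _ _ _ _).2 hn⟩, rfl⟩
  have hinner : ∀ n : ℕ, ∑' _ : {w // w ∈ passages l n ((p : ℤ), 0)}, t ^ n =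
      (passageCount n p : ℝ) * lineCount n l * t ^ n := by
    intro n
    have hc := card_passages l n ((p : ℤ), 0)
    simp only [sub_zero] at hc
    rw [tsum_fintype, Finset.sum_const, Finset.card_univ, Fintype.card_coe, nsmul_eq_mul]
    congr 1
    exact_mod_cast hc
  have hsum : Summable fun x : (Σ n : ℕ, {w // w ∈ passages l n ((p : ℤ), 0)}) => t ^ x.1 := by
    rw [summable_sigma_of_nonneg (fun x => pow_nonneg ht.1.le _)]
    refine ⟨fun n => (hasSum_fintype _).summable, ?_⟩
    simp only [hinner]
    have hgeo : Summable fun n : ℕ => (4 * t) ^ n :=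
      summable_geometric_of_lt_one (by linarith [ht.1]) (by linarith [ht.2])
    have hpn : ∀ n, (0 : ℝ) ≤ passageCount n p := fun n => by
      exact_mod_cast passageCount_nonneg n p
    have hln : ∀ n, (0 : ℝ) ≤ lineCount n l := fun n => by
      exact_mod_cast lineCount_nonneg n l
    refine Summable.of_nonneg_of_le (fun n => ?_) (fun n => ?_) hgeo
    · exact mul_nonneg (mul_nonneg (hpn n) (hln n)) (pow_nonneg ht.1.le n)
    · rw [mul_pow, show (4 : ℝ) = 2 * 2 by norm_num, mul_pow]
      refine mul_le_mul_of_nonneg_right ?_ (pow_nonneg ht.1.le n)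
      refine mul_le_mul ?_ ?_ (hln n) (by positivity)
      · exact_mod_cast passageCount_le n p
      · exact_mod_cast lineCount_le n l
  rw [Wgen, ← (Equiv.ofBijective g hg).tsum_eq]
  simp only [Equiv.ofBijective_apply, hlen]
  rw [hsum.tsum_sigma]
  exact tsum_congr hinner

lemma rpow_half_nat {k : ℝ} (hk : 0 < k) (n : ℕ) :
    (k / 4) ^ ((n : ℝ) / 2) = (Real.sqrt k / 2) ^ n := by
  have h4 : Real.sqrt 4 = 2 := by
    rw [show (4 : ℝ) = 2 ^ 2 by norm_num, Real.sqrt_sq two_pos.le]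
  rw [show Real.sqrt k / 2 = Real.sqrt (k / 4) by rw [Real.sqrt_div hk.le, h4],
    Real.sqrt_eq_rpow, ← Real.rpow_natCast,
    ← Real.rpow_mul (by positivity)]
  congr 1
  ring

lemma passageCount_eq_div (n p : ℕ) (hn : 1 ≤ n) (hp : 1 ≤ p) :
    (passageCount n p : ℝ) =
      if p ≤ n ∧ Even (n + p) then (p : ℝ) / n * n.choose ((n + p) / 2) else 0 := by
  have h : (n : ℝ) * passageCount n p =
      if p ≤ n ∧ Even (n + p) then (p : ℝ) * n.choose ((n + p) / 2) else 0 := by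
    exact_mod_cast mul_passageCount n p hp
  have hn0 : (n : ℝ) ≠ 0 := by positivity
  rw [← mul_right_inj' hn0, h]
  split_ifs
  · field_simp
  · simp

/-- `l` times the number of walks is symmetric in `l` and `p`. -/
lemma mul_passageCount_mul_lineCount (n l p : ℕ) (hl : 1 ≤ l) :
    (l : ℤ) * (passageCount n p * lineCount n l) =
      n * passageCount n l * passageCount n p := by
  rw [mul_passageCount n l hl, lineCount_natCast]
  split_ifs <;> ring

/-- Lemma on `ψ_k` and `J_{l,p}` (Section 2.1): (a) the Taylor coefficients of `ψ_k(z)^p`;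
(b) the explicit form of `J_{l,p}(t) = W^{(π/2,(-π/2,π/2))}_{l,p}(t)`;
(c) `l·J_{l,p}(t) = Σ_n n [zⁿ]ψ_k^l [zⁿ]ψ_k^p`. -/
theorem statement2 (t : ℝ) (ht : t ∈ Set.Ioo (0 : ℝ) (1 / 4)) (k : ℝ) (hk : k = 4 * t)
    (l p : ℕ) (hl : 1 ≤ l) (hp : 1 ≤ p)
    (cl cp : ℕ → ℂ)
    (hcl : ∀ z : ℂ, ‖z‖ < 1 → HasSum (fun n : ℕ => cl n * z ^ n) (psiK k z ^ l))
    (hcp : ∀ z : ℂ, ‖z‖ < 1 → HasSum (fun n : ℕ => cp n * z ^ n) (psiK k z ^ p)) :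
    (∀ n : ℕ, 1 ≤ n →
        cp n = if p ≤ n ∧ Even (n + p) then
            (((k / 4) ^ ((n : ℝ) / 2) * ((p : ℝ) / n) * (n.choose ((n + p) / 2)) : ℝ) : ℂ)
          else 0) ∧
    Wgen t l p (π / 2) (Set.Ioo (-(π / 2)) (π / 2)) =
      (∑' n : ℕ, if l ≤ n ∧ Even (n + l) ∧ p ≤ n ∧ Even (n + p) then
          ((p : ℝ) / n) * (n.choose ((n + l) / 2)) * (n.choose ((n + p) / 2)) * t ^ n
        else 0) ∧
    (l : ℂ) * (Wgen t l p (π / 2) (Set.Ioo (-(π / 2)) (π / 2)) : ℝ) =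
      ∑' n : ℕ, (n : ℂ) * cl n * cp n := by
  have hk0 : 0 < k := by rw [hk]; linarith [ht.1]
  have hball : ∀ᶠ z in nhds (0 : ℂ), ‖z‖ < 1 := by
    filter_upwards [Metric.ball_mem_nhds (0 : ℂ) one_pos] with z hz
    simpa using hz
  have hcl' := psiK_pow_coeff hk0 l cl (hball.mono hcl)
  have hcp' := psiK_pow_coeff hk0 p cp (hball.mono hcp)
  refine ⟨fun n hn => ?_, ?_, ?_⟩
  · have h := passageCount_eq_div n p hn hp
    have h' : (passageCount n p : ℂ) = ((passageCount n p : ℝ) : ℂ) := by push_cast; rfl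
    rw [hcp', h', h, rpow_half_nat hk0]
    split_ifs
    · push_cast
      ring
    · simp
  · rw [Wgen_eq_tsum ht hl hp]
    refine tsum_congr fun n => ?_
    rcases Nat.eq_zero_or_pos n with rfl | hn
    · rw [if_neg (by omega), passageCount, if_neg (by omega)]
      simp
    · have h : (lineCount n l : ℝ) =
          if l ≤ n ∧ Even (n + l) then (n.choose ((n + l) / 2) : ℝ) else 0 := by
        exact_mod_cast lineCount_natCast n l
      rw [passageCount_eq_div n p hn hp, h]
      split_ifs <;> first | (exfalso; tauto) | ring
  · rw [Wgen_eq_tsum ht hl hp, Complex.ofReal_tsum, ← tsum_mul_left]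
    refine tsum_congr fun n => ?_
    have hkt : ((Real.sqrt k : ℂ) / 2) ^ n * ((Real.sqrt k : ℂ) / 2) ^ n = (t : ℂ) ^ n := by
      rw [← mul_pow]
      congr 1
      have hs2 : (Real.sqrt k : ℂ) ^ 2 = k := by exact_mod_cast Real.sq_sqrt hk0.le
      have hk' : (k : ℂ) = 4 * t := by rw [hk]; push_cast; rfl
      linear_combination hs2 / 4 + hk' / 4
    have h : (l : ℂ) * (passageCount n p * lineCount n l) =
        n * passageCount n l * passageCount n p := by
      exact_mod_cast mul_passageCount_mul_lineCount n l p hl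
    rw [hcl', hcp']
    push_cast
    linear_combination (t : ℂ) ^ n * h - n * passageCount n l * passageCount n p * hkt

end
end

section
/- Fix k ∈ (0,1) and let ψ_k(z) = (1 − √(1−kz²))/(√k·z) (principal square root, ψ_k(0)=0), which maps the open unit disc 𝔻 biholomorphically onto a subset ψ_k(𝔻) ⊂ 𝔻. Then T_{k₁} = 2T_k, and the function v_{k₁} maps 𝔻 ∖ {z ∈ ℝ : z² ≥ k₁} biholomorphically onto the open rectangle (−1/4,1/4) + i(−T_{k₁}/2, T_{k₁}/2), and maps ψ_k(𝔻) ∖ {z ∈ ℝ : z² ≥ k₁} biholomorphically onto the open rectangle (−1/4,1/4) + i(−T_k/2, T_k/2). -/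
open Complex Real Set

noncomputable section

/-- The open rectangle `(-1/4,1/4) + i(-T/2, T/2)`. -/
def rectDom (T : ℝ) : Set ℂ :=
  {z : ℂ | z.re ∈ Set.Ioo (-(1 / 4) : ℝ) (1 / 4) ∧ z.im ∈ Set.Ioo (-(T / 2)) (T / 2)}

lemma Kell_eq_Ioo (k : ℝ) :
    Kell k = ∫ y in Ioo (0:ℝ) 1, 1 / Real.sqrt ((1 - y ^ 2) * (1 - k ^ 2 * y ^ 2)) := by
  rw [Kell, intervalIntegral.integral_of_le zero_le_one, MeasureTheory.integral_Ioc_eq_integral_Ioo]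

lemma kComp_mem {k : ℝ} (hk : k ∈ Ioo (0 : ℝ) 1) : kComp k ∈ Ioo (0 : ℝ) 1 := by
  have h0 := hk.1
  have h1 := hk.2
  refine ⟨Real.sqrt_pos.2 (by nlinarith), ?_⟩
  rw [kComp, Real.sqrt_lt' one_pos]
  nlinarith [pow_pos h0 2]

lemma kComp_sq {k : ℝ} (hk : k ∈ Ioo (0 : ℝ) 1) : kComp k ^ 2 = 1 - k ^ 2 :=
  Real.sq_sqrt (by nlinarith [hk.1, hk.2])

lemma kLanden_mem {k : ℝ} (hk : k ∈ Ioo (0 : ℝ) 1) : kLanden k ∈ Ioo (0 : ℝ) 1 := by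
  obtain ⟨h0, h1⟩ := kComp_mem hk
  rw [kLanden]
  refine ⟨div_pos (by linarith) (by linarith), ?_⟩
  rw [div_lt_one (by linarith)]
  linarith

lemma one_add_kLanden {k : ℝ} (hk : k ∈ Ioo (0 : ℝ) 1) :
    1 + kLanden k = 2 / (1 + kComp k) := by
  have := (kComp_mem hk).1
  rw [kLanden]
  field_simp
  ring

lemma one_sub_kLanden {k : ℝ} (hk : k ∈ Ioo (0 : ℝ) 1) :
    1 - kLanden k = (1 + kLanden k) * kComp k := by
  have := (kComp_mem hk).1
  rw [kLanden]
  field_simp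
  ring

lemma four_mul_kLanden {k : ℝ} (hk : k ∈ Ioo (0 : ℝ) 1) :
    4 * kLanden k = (1 + kLanden k) ^ 2 * k ^ 2 := by
  have h := one_sub_kLanden hk
  have h2 := kComp_sq hk
  have h3 : (1 - kLanden k) ^ 2 = (1 + kLanden k) ^ 2 * (1 - k ^ 2) := by rw [h, mul_pow, h2]
  linarith

lemma kComp_kComp {k : ℝ} (hk : k ∈ Ioo (0 : ℝ) 1) : kComp (kComp k) = k := by
  rw [kComp, kComp_sq hk]
  simp [hk.1.le]

/-- The descending Landen transformation of the complete elliptic integral. -/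
lemma Kell_landen {k : ℝ} (hk : k ∈ Ioo (0 : ℝ) 1) :
    Kell k = (1 + kLanden k) * Kell (kLanden k) := by
  set κ := kLanden k with hκ
  obtain ⟨h0, h1⟩ : κ ∈ Ioo (0 : ℝ) 1 := kLanden_mem hk
  have hk4 : 4 * κ = (1 + κ) ^ 2 * k ^ 2 := four_mul_kLanden hk
  have hpos : ∀ s : ℝ, 0 < 1 + κ * s ^ 2 := fun s => by positivity
  let f : ℝ → ℝ := fun s => (1 + κ) * s / (1 + κ * s ^ 2)
  have hf : ∀ s, HasDerivAt f ((1 + κ) * (1 - κ * s ^ 2) / (1 + κ * s ^ 2) ^ 2) s := fun s => by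
    have h := ((hasDerivAt_id s).const_mul (1 + κ)).div
      ((((hasDerivAt_id s).pow 2).const_mul κ).const_add 1) (hpos s).ne'
    refine h.congr_deriv ?_
    simp
    ring
  have hinj : InjOn f (Ioo 0 1) := by
    intro s hs t ht hst
    have h := hst
    simp only [f] at h
    rw [div_eq_div_iff (hpos s).ne' (hpos t).ne'] at h
    have h2 : (1 + κ) * ((s - t) * (1 - κ * (s * t))) = 0 := by linear_combination h
    have hst1 : s * t < 1 := by nlinarith [hs.1, hs.2, ht.1, ht.2]
    have hst0 : 0 < s * t := mul_pos hs.1 ht.1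
    have h3 : (1 - κ * (s * t)) ≠ 0 := by nlinarith
    have h4 : 1 + κ ≠ 0 := by linarith
    have := (mul_eq_zero.1 ((mul_eq_zero.1 h2).resolve_left h4)).resolve_right h3
    linarith
  have himg : f '' Ioo 0 1 = Ioo 0 1 := by
    apply Subset.antisymm
    · rintro _ ⟨s, hs, rfl⟩
      have := hs.1
      refine ⟨by simp only [f]; positivity, ?_⟩
      simp only [f]
      rw [div_lt_one (hpos s)]
      nlinarith [mul_pos (sub_pos.2 hs.2) (show 0 < 1 - κ * s by nlinarith [hs.1, hs.2])]
    · have hc : ContinuousOn f (Icc 0 1) := fun s _ => (hf s).continuousAt.continuousWithinAt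
      have h := intermediate_value_Ioo (zero_le_one) hc
      have e0 : f 0 = 0 := by simp [f]
      have e1 : f 1 = 1 := by simp only [f]; field_simp
      rwa [e0, e1] at h
  rw [Kell_eq_Ioo, Kell_eq_Ioo, ← MeasureTheory.integral_const_mul]
  conv_lhs => rw [← himg]
  rw [MeasureTheory.integral_image_eq_integral_abs_deriv_smul measurableSet_Ioo
    (fun s _ => (hf s).hasDerivWithinAt) hinj]
  apply MeasureTheory.setIntegral_congr_fun measurableSet_Ioo
  intro s hs
  have hs2 : s ^ 2 < 1 := by nlinarith [hs.1, hs.2]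
  have hA : 0 < 1 - κ * s ^ 2 := by nlinarith [sq_nonneg s]
  have hB : 0 < (1 - s ^ 2) * (1 - κ ^ 2 * s ^ 2) := by
    apply mul_pos (by linarith)
    nlinarith [sq_nonneg s]
  have key : (1 - f s ^ 2) * (1 - k ^ 2 * f s ^ 2)
      = ((1 - s ^ 2) * (1 - κ ^ 2 * s ^ 2)) * ((1 - κ * s ^ 2) / (1 + κ * s ^ 2) ^ 2) ^ 2 := by
    simp only [f]
    have hne := (hpos s).ne'
    have e1 : k ^ 2 * ((1 + κ) * s / (1 + κ * s ^ 2)) ^ 2 = 4 * κ * s ^ 2 / (1 + κ * s ^ 2) ^ 2 := by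
      rw [hk4, div_pow]; ring
    rw [e1]
    field_simp
    ring
  have hpos' := hpos s
  have hC : 0 < (1 - κ * s ^ 2) / (1 + κ * s ^ 2) ^ 2 := by positivity
  simp only [smul_eq_mul]
  rw [key, Real.sqrt_mul hB.le, Real.sqrt_sq hC.le, abs_of_pos (by positivity)]
  have := Real.sqrt_pos.2 hB
  field_simp

lemma kLanden_kComp {k : ℝ} (hk : k ∈ Ioo (0 : ℝ) 1) :
    kLanden (kComp k) = (1 - k) / (1 + k) := by
  rw [kLanden, kComp_kComp hk]

lemma kLanden_kComp_kLanden {k : ℝ} (hk : k ∈ Ioo (0 : ℝ) 1) :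
    kLanden (kComp (kLanden k)) = kComp k := by
  have h := kLanden_mem hk
  rw [kLanden_kComp h, one_sub_kLanden hk]
  have := h.1
  field_simp

lemma integral_imag_axis {κ : ℝ} (hκ : κ ∈ Ioo (0 : ℝ) 1) :
    ∫ y in (0:ℝ)..1, 1 / Real.sqrt ((κ + y ^ 2) * (1 + κ * y ^ 2)) = Kell (kComp κ) / 2 := by
  have h0 := hκ.1
  have h1 := hκ.2
  rw [Kell_landen (kComp_mem hκ), kLanden_kComp hκ, Kell_eq_Ioo,
    intervalIntegral.integral_of_le zero_le_one, MeasureTheory.integral_Ioc_eq_integral_Ioo]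
  have hpos : ∀ s : ℝ, 0 < 1 + s ^ 2 := fun s => by positivity
  let f : ℝ → ℝ := fun s => (1 - s ^ 2) / (1 + s ^ 2)
  have hf : ∀ s, HasDerivAt f (-(4 * s) / (1 + s ^ 2) ^ 2) s := fun s => by
    have h := (((hasDerivAt_id s).pow 2).const_sub 1).div
      (((hasDerivAt_id s).pow 2).const_add 1) (hpos s).ne'
    refine h.congr_deriv ?_
    simp
    ring
  have hinj : InjOn f (Ioo 0 1) := by
    intro s hs t ht hst
    have h := hst
    simp only [f] at h
    rw [div_eq_div_iff (hpos s).ne' (hpos t).ne'] at h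
    have h2 : (s - t) * (s + t) = 0 := by linear_combination (-1 / 2) * h
    have h3 : s + t ≠ 0 := by linarith [hs.1, ht.1]
    have := (mul_eq_zero.1 h2).resolve_right h3
    linarith
  have himg : f '' Ioo 0 1 = Ioo 0 1 := by
    apply Subset.antisymm
    · rintro _ ⟨s, hs, rfl⟩
      have := hs.1
      have : 0 < 1 - s ^ 2 := by nlinarith [hs.1, hs.2]
      refine ⟨by simp only [f]; positivity, ?_⟩
      simp only [f]
      rw [div_lt_one (hpos s)]
      nlinarith [hs.1]
    · have hc : ContinuousOn f (Icc 0 1) := fun s _ => (hf s).continuousAt.continuousWithinAt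
      have h := intermediate_value_Ioo' (zero_le_one) hc
      have e0 : f 0 = 1 := by simp [f]
      have e1 : f 1 = 0 := by simp [f]
      rwa [e0, e1] at h
  conv_rhs => rw [← himg]
  rw [MeasureTheory.integral_image_eq_integral_abs_deriv_smul measurableSet_Ioo
    (fun s _ => (hf s).hasDerivWithinAt) hinj, mul_div_right_comm,
    ← MeasureTheory.integral_const_mul]
  apply MeasureTheory.setIntegral_congr_fun measurableSet_Ioo
  intro s hs
  have hs0 := hs.1
  have hB : 0 < (κ + s ^ 2) * (1 + κ * s ^ 2) := by positivity
  have key : (1 - f s ^ 2) * (1 - ((1 - κ) / (1 + κ)) ^ 2 * f s ^ 2)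
      = ((κ + s ^ 2) * (1 + κ * s ^ 2)) * (4 * s / ((1 + κ) * (1 + s ^ 2) ^ 2)) ^ 2 := by
    simp only [f]
    field_simp
    ring
  have hC : 0 < 4 * s / ((1 + κ) * (1 + s ^ 2) ^ 2) := by positivity
  simp only [smul_eq_mul]
  rw [key, Real.sqrt_mul hB.le, Real.sqrt_sq hC.le, neg_div, abs_neg, abs_of_pos (by positivity)]
  have := Real.sqrt_pos.2 hB
  field_simp
  ring

lemma Kell_integrable {κ : ℝ} (hκ : κ ∈ Ioo (0 : ℝ) 1) :
    IntervalIntegrable (fun y : ℝ => 1 / Real.sqrt ((1 - y ^ 2) * (1 - κ ^ 2 * y ^ 2)))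
      MeasureTheory.volume 0 1 := by
  obtain ⟨h0, h1⟩ := hκ
  have h2 : IntervalIntegrable (fun y : ℝ => (1 / Real.sqrt (1 - κ ^ 2)) * (1 - y) ^ (-(1/2) : ℝ))
      MeasureTheory.volume 0 1 := by
    have h := (intervalIntegral.intervalIntegrable_rpow' (a := 1) (b := 0) (r := -(1/2))
      (by norm_num)).comp_sub_left 1
    simp only [sub_self, sub_zero] at h
    exact h.const_mul _
  refine h2.mono_fun (Measurable.aestronglyMeasurable (by fun_prop)) ?_
  rw [uIoc_of_le zero_le_one, ← MeasureTheory.restrict_Ioo_eq_restrict_Ioc]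
  filter_upwards [MeasureTheory.ae_restrict_mem measurableSet_Ioo] with y hy
  have hy1 : 0 < 1 - y := by linarith [hy.2]
  have hk1 : 0 < 1 - κ ^ 2 := by nlinarith
  rw [Real.rpow_neg hy1.le, ← Real.sqrt_eq_rpow, norm_mul, Real.norm_of_nonneg (by positivity),
    Real.norm_of_nonneg (by positivity), Real.norm_of_nonneg (by positivity), one_div, one_div,
    ← mul_inv, ← Real.sqrt_mul hk1.le]
  have : 0 < Real.sqrt ((1 - κ ^ 2) * (1 - y)) := Real.sqrt_pos.2 (by positivity)
  gcongr ?_⁻¹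
  apply Real.sqrt_le_sqrt
  have hy2 : y ^ 2 ≤ y := by nlinarith [hy.1, hy.2]
  have hy3 : κ ^ 2 * y ^ 2 ≤ κ ^ 2 := by nlinarith [hy.1, hy.2, sq_nonneg κ]
  nlinarith [mul_nonneg (show 0 ≤ 1 - y ^ 2 - (1 - y) by linarith)
    (show 0 ≤ 1 - κ ^ 2 * y ^ 2 by linarith)]

lemma Kell_pos {κ : ℝ} (hκ : κ ∈ Ioo (0 : ℝ) 1) : 0 < Kell κ := by
  have h0 := hκ.1
  have h1 := hκ.2
  refine intervalIntegral.intervalIntegral_pos_of_pos_on (Kell_integrable hκ) ?_ zero_lt_one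
  intro y hy
  have hy2 : y ^ 2 < 1 := by nlinarith [hy.1, hy.2]
  have h3 : 0 < 1 - κ ^ 2 * y ^ 2 := by nlinarith [sq_nonneg y]
  have h4 : 0 < 1 - y ^ 2 := by linarith
  positivity

lemma Tell_landen {k : ℝ} (hk : k ∈ Ioo (0 : ℝ) 1) : Tell (kLanden k) = 2 * Tell k := by
  have h1 := kLanden_mem hk
  have e1 := Kell_landen hk
  have e2 := Kell_landen (kComp_mem h1)
  rw [kLanden_kComp_kLanden hk] at e2
  have e3 := one_add_kLanden hk
  have hp := Kell_pos h1
  have hp2 := (kComp_mem hk).1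
  rw [Tell, Tell, e2, e1, e3]
  field_simp

lemma csqrt_sq (a : ℂ) : Complex.sqrt a ^ 2 = a := Complex.cpow_ofNat_inv_pow a 2

lemma csqrt_sq_of_re_pos {w : ℂ} (hw : 0 < w.re) : Complex.sqrt (w ^ 2) = w :=
  Complex.sq_cpow_two_inv hw

lemma csqrt_re_pos {a : ℂ} (ha : a ∈ slitPlane) : 0 < (Complex.sqrt a).re := by
  have h0 : a ≠ 0 := slitPlane_ne_zero ha
  rw [Complex.sqrt, cpow_def_of_ne_zero h0, Complex.exp_re]
  have him : (Complex.log a * 2⁻¹).im = a.arg / 2 := by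
    have : (2⁻¹ : ℂ) = ((2⁻¹ : ℝ) : ℂ) := by push_cast; rfl
    rw [this, Complex.im_mul_ofReal, Complex.log_im]
    ring
  rw [him]
  have h1 : a.arg < π := lt_of_le_of_ne (Complex.arg_le_pi a) (mem_slitPlane_iff_arg.1 ha).1
  have h2 := Complex.neg_pi_lt_arg a
  exact mul_pos (Real.exp_pos _) (Real.cos_pos_of_mem_Ioo ⟨by linarith, by linarith⟩)

lemma two_mul_re_mul_im (w : ℂ) : 2 * w.re * w.im = (w ^ 2).im := by
  rw [sq, Complex.mul_im]; ring

lemma two_mul_csqrt_re_mul_im (a : ℂ) :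
    2 * (Complex.sqrt a).re * (Complex.sqrt a).im = a.im := by
  rw [two_mul_re_mul_im, csqrt_sq]

lemma csqrt_conj {a : ℂ} (ha : a ∈ slitPlane) :
    Complex.sqrt ((starRingEnd ℂ) a) = (starRingEnd ℂ) (Complex.sqrt a) := by
  have h : (starRingEnd ℂ) a = ((starRingEnd ℂ) (Complex.sqrt a)) ^ 2 := by rw [← map_pow, csqrt_sq]
  rw [h, csqrt_sq_of_re_pos (by simpa using csqrt_re_pos ha)]

lemma csqrt_ofReal {x : ℝ} (hx : 0 < x) : Complex.sqrt (x : ℂ) = (Real.sqrt x : ℂ) := by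
  have h : (x : ℂ) = (Real.sqrt x : ℂ) ^ 2 := by
    rw [← Complex.ofReal_pow, Real.sq_sqrt hx.le]
  conv_lhs => rw [h]
  exact csqrt_sq_of_re_pos (by simpa using hx)

lemma analyticAt_csqrt {f : ℂ → ℂ} {z : ℂ} (hf : AnalyticAt ℂ f z) (h : f z ∈ slitPlane) :
    AnalyticAt ℂ (fun z => Complex.sqrt (f z)) z :=
  hf.cpow analyticAt_const h

lemma re_sub_sq (a b : ℝ) (z : ℂ) : ((a : ℂ) - b * z ^ 2).re = a - b * (z.re ^ 2 - z.im ^ 2) := by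
  simp [sq]

lemma im_sub_sq (a b : ℝ) (z : ℂ) : ((a : ℂ) - b * z ^ 2).im = - b * (2 * z.re * z.im) := by
  rw [sq, Complex.sub_im, Complex.ofReal_im, Complex.im_ofReal_mul, Complex.mul_im]; ring

lemma sub_sq_mem_slitPlane {a b : ℝ} (ha : 0 < a) (hb : 0 < b) {z : ℂ}
    (hz : z ∈ slitDom (a / b)) : (a : ℂ) - b * z ^ 2 ∈ slitPlane := by
  rw [mem_slitPlane_iff, re_sub_sq, im_sub_sq]
  by_cases him : z.im = 0
  · left
    have h : z.re ^ 2 < a / b := by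
      by_contra h
      exact hz ⟨him, not_lt.1 h⟩
    rw [lt_div_iff₀ hb] at h
    rw [him]
    nlinarith
  · by_cases hre : z.re = 0
    · left
      rw [hre]
      nlinarith [mul_nonneg hb.le (sq_nonneg z.im)]
    · right
      have : b * (2 * z.re * z.im) ≠ 0 := by positivity
      simpa using this

lemma slitDom_mono {a b : ℝ} (h : a ≤ b) : slitDom a ⊆ slitDom b :=
  fun _ hz hz' => hz ⟨hz'.1, h.trans hz'.2⟩

lemma mem_slitPlane_left {κ : ℝ} (hκ : κ ∈ Ioo (0 : ℝ) 1) {z : ℂ} (hz : z ∈ slitDom κ) :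
    (κ : ℂ) - z ^ 2 ∈ slitPlane := by
  have := sub_sq_mem_slitPlane (b := 1) hκ.1 one_pos (z := z) (by simpa using hz)
  simpa using this

lemma mem_slitPlane_right {κ : ℝ} (hκ : κ ∈ Ioo (0 : ℝ) 1) {z : ℂ} (hz : z ∈ slitDom κ) :
    1 - (κ : ℂ) * z ^ 2 ∈ slitPlane := by
  have h : κ ≤ 1 / κ := by
    rw [le_div_iff₀ hκ.1]
    nlinarith [hκ.1, hκ.2]
  have := sub_sq_mem_slitPlane one_pos hκ.1 (slitDom_mono h hz)
  simpa using this

lemma starConvex_slitDom {κ : ℝ} (hκ : 0 < κ) : StarConvex ℝ 0 (slitDom κ) := by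
  rw [starConvex_zero_iff]
  intro z hz t ht0 ht1 h
  rw [Complex.real_smul, Complex.re_ofReal_mul, Complex.im_ofReal_mul] at h
  have ht : t ≠ 0 := by
    rintro rfl
    have := h.2
    norm_num at this
    linarith
  refine hz ⟨(mul_eq_zero.1 h.1).resolve_left ht, h.2.trans ?_⟩
  rw [mul_pow]
  have : t ^ 2 ≤ 1 := by nlinarith
  nlinarith [sq_nonneg z.re]

lemma ofReal_mul_mem_slitDom {κ : ℝ} (hκ : 0 < κ) {z : ℂ} (hz : z ∈ slitDom κ) {t : ℝ}
    (ht : t ∈ Icc (0 : ℝ) 1) : (t : ℂ) * z ∈ slitDom κ := by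
  have := starConvex_zero_iff.1 (starConvex_slitDom hκ) hz ht.1 ht.2
  rwa [Complex.real_smul] at this

lemma zero_mem_slitDom {κ : ℝ} (hκ : 0 < κ) : (0 : ℂ) ∈ slitDom κ := by
  simp [slitDom, hκ]

lemma ofReal_mem_slitDom {κ x : ℝ} : (x : ℂ) ∈ slitDom κ ↔ x ^ 2 < κ := by
  simp [slitDom]

lemma mem_slitDom_of_im_ne {κ : ℝ} {z : ℂ} (h : z.im ≠ 0) : z ∈ slitDom κ := fun h' => h h'.1

lemma isOpen_slitDom (κ : ℝ) : IsOpen (slitDom κ) := by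
  have : IsClosed {z : ℂ | z.im = 0 ∧ κ ≤ z.re ^ 2} :=
    (isClosed_eq Complex.continuous_im continuous_const).inter
      (isClosed_le continuous_const (Complex.continuous_re.pow 2))
  exact this.isOpen_compl

lemma neg_mem_slitDom {κ : ℝ} {z : ℂ} (hz : z ∈ slitDom κ) : -z ∈ slitDom κ := by
  simpa [slitDom] using hz

lemma conj_mem_slitDom {κ : ℝ} {z : ℂ} (hz : z ∈ slitDom κ) : (starRingEnd ℂ) z ∈ slitDom κ := by
  simpa [slitDom] using hz

/-- The derivative of `v_κ` on the slit plane. -/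
def vDeriv (κ : ℝ) (z : ℂ) : ℂ :=
  1 / ((4 * Kell κ : ℝ) * (Complex.sqrt (κ - z ^ 2) * Complex.sqrt (1 - κ * z ^ 2)))

lemma vDeriv_neg (κ : ℝ) (z : ℂ) : vDeriv κ (-z) = vDeriv κ z := by
  simp [vDeriv]

lemma vDeriv_conj {κ : ℝ} (hκ : κ ∈ Ioo (0 : ℝ) 1) {z : ℂ} (hz : z ∈ slitDom κ) :
    vDeriv κ ((starRingEnd ℂ) z) = (starRingEnd ℂ) (vDeriv κ z) := by
  have e1 : (κ : ℂ) - ((starRingEnd ℂ) z) ^ 2 = (starRingEnd ℂ) ((κ : ℂ) - z ^ 2) := by simp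
  have e2 : 1 - (κ : ℂ) * ((starRingEnd ℂ) z) ^ 2 = (starRingEnd ℂ) (1 - (κ : ℂ) * z ^ 2) := by simp
  rw [vDeriv, vDeriv, e1, e2, csqrt_conj (mem_slitPlane_left hκ hz),
    csqrt_conj (mem_slitPlane_right hκ hz)]
  simp only [map_div₀, map_mul, map_one, Complex.conj_ofReal]

lemma csqrt_ne_zero {a : ℂ} (ha : a ∈ slitPlane) : Complex.sqrt a ≠ 0 := by
  intro h
  have := csqrt_re_pos ha
  rw [h] at this
  simp at this

lemma vDeriv_ofReal {κ : ℝ} (hκ : κ ∈ Ioo (0 : ℝ) 1) {x : ℝ} (hx : x ^ 2 < κ) :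
    vDeriv κ x
      = ((1 / (4 * Kell κ * Real.sqrt ((κ - x ^ 2) * (1 - κ * x ^ 2))) : ℝ) : ℂ) := by
  have h1 : 0 < κ - x ^ 2 := by linarith
  have h2 : 0 < 1 - κ * x ^ 2 := by nlinarith [hκ.1, hκ.2, sq_nonneg x]
  have e1 : (κ : ℂ) - (x : ℂ) ^ 2 = ((κ - x ^ 2 : ℝ) : ℂ) := by push_cast; rfl
  have e2 : 1 - (κ : ℂ) * (x : ℂ) ^ 2 = ((1 - κ * x ^ 2 : ℝ) : ℂ) := by push_cast; rfl
  rw [vDeriv, e1, e2, csqrt_ofReal h1, csqrt_ofReal h2, Real.sqrt_mul h1.le]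
  push_cast
  rfl

lemma analyticOnNhd_vDeriv {κ : ℝ} (hκ : κ ∈ Ioo (0 : ℝ) 1) :
    AnalyticOnNhd ℂ (vDeriv κ) (slitDom κ) := by
  intro z hz
  have h1 := mem_slitPlane_left hκ hz
  have h2 := mem_slitPlane_right hκ hz
  have a1 : AnalyticAt ℂ (fun z : ℂ => Complex.sqrt ((κ : ℂ) - z ^ 2)) z :=
    analyticAt_csqrt (by fun_prop) h1
  have a2 : AnalyticAt ℂ (fun z : ℂ => Complex.sqrt (1 - (κ : ℂ) * z ^ 2)) z :=
    analyticAt_csqrt (by fun_prop) h2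
  refine analyticAt_const.div (analyticAt_const.mul (a1.mul a2)) ?_
  have hK := Kell_pos hκ
  refine mul_ne_zero (by exact_mod_cast (by positivity)) (mul_ne_zero ?_ ?_)
  · exact csqrt_ne_zero h1
  · exact csqrt_ne_zero h2

lemma IsVmap.hasDerivAt {κ : ℝ} (hκ : κ ∈ Ioo (0 : ℝ) 1) {v : ℂ → ℂ} (hv : IsVmap κ v) {z : ℂ}
    (hz : z ∈ slitDom κ) : HasDerivAt v (vDeriv κ z) z := by
  have hpre : IsPreconnected (slitDom κ) :=
    ((starConvex_slitDom hκ.1).isPathConnected (zero_mem_slitDom hκ.1)).isConnected.isPreconnected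
  have heq : EqOn (deriv v) (vDeriv κ) (slitDom κ) := by
    refine hv.analytic.deriv.eqOn_of_preconnected_of_frequently_eq (analyticOnNhd_vDeriv hκ) hpre
      (zero_mem_slitDom hκ.1) ?_
    have ht : Filter.Tendsto (fun x : ℝ => (x : ℂ)) (nhdsWithin 0 {0}ᶜ) (nhdsWithin 0 {0}ᶜ) := by
      apply tendsto_nhdsWithin_of_tendsto_nhds_of_eventually_within
      · have : Filter.Tendsto (fun x : ℝ => (x : ℂ)) (nhds 0) (nhds ((0 : ℝ) : ℂ)) :=
          Complex.continuous_ofReal.tendsto 0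
        exact this.mono_left nhdsWithin_le_nhds
      · filter_upwards [self_mem_nhdsWithin] with x hx
        simpa using hx
    refine ht.frequently (Filter.Eventually.frequently ?_)
    have hev : ∀ᶠ x : ℝ in nhds 0, x ^ 2 < κ :=
      (continuous_pow 2).tendsto' (0 : ℝ) 0 (by simp) |>.eventually (gt_mem_nhds hκ.1)
    filter_upwards [nhdsWithin_le_nhds hev] with x hx
    rw [(hv.deriv_real x hx).deriv, vDeriv_ofReal hκ hx]
  rw [← heq hz]
  exact (hv.analytic z hz).differentiableAt.hasDerivAt

/-- The values of `1 / v_κ'` in the first quadrant. -/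
lemma csqrt_mul_csqrt_quadrant {κ : ℝ} (hκ : κ ∈ Ioo (0 : ℝ) 1) {z : ℂ} (hz : z ∈ slitDom κ)
    (hre : 0 ≤ z.re) (him : 0 ≤ z.im) (hnorm : ‖z‖ ≤ 1) :
    0 < (Complex.sqrt (κ - z ^ 2) * Complex.sqrt (1 - κ * z ^ 2)).re ∧
      (Complex.sqrt (κ - z ^ 2) * Complex.sqrt (1 - κ * z ^ 2)).im ≤ 0 := by
  have h0 := hκ.1
  have h1 := hκ.2
  have hα := csqrt_re_pos (mem_slitPlane_left hκ hz)
  have hβ := csqrt_re_pos (mem_slitPlane_right hκ hz)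
  have hα' := two_mul_csqrt_re_mul_im (κ - z ^ 2)
  have hβ' := two_mul_csqrt_re_mul_im (1 - κ * z ^ 2)
  have hsq : (Complex.sqrt (κ - z ^ 2) * Complex.sqrt (1 - κ * z ^ 2)) ^ 2
      = (κ - z ^ 2) * (1 - κ * z ^ 2) := by rw [mul_pow, csqrt_sq, csqrt_sq]
  have hab := two_mul_re_mul_im (Complex.sqrt (κ - z ^ 2) * Complex.sqrt (1 - κ * z ^ 2))
  rw [hsq] at hab
  set α := Complex.sqrt (κ - z ^ 2)
  set β := Complex.sqrt (1 - κ * z ^ 2)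
  have ia := im_sub_sq κ 1 z
  have ib := im_sub_sq 1 κ z
  have iab : ((κ - z ^ 2) * (1 - κ * z ^ 2)).im
      = 2 * (z.re * z.im) * (-(1 + κ ^ 2) + 2 * κ * (z.re ^ 2 - z.im ^ 2)) := by
    simp [sq]; ring
  simp only [Complex.ofReal_one, one_mul] at ia ib
  rw [ia] at hα'
  rw [ib] at hβ'
  rw [iab] at hab
  have hn : z.re ^ 2 + z.im ^ 2 ≤ 1 := by
    have := Complex.sq_norm z
    rw [Complex.normSq_apply] at this
    nlinarith [norm_nonneg z]
  have hxy : 0 ≤ z.re * z.im := mul_nonneg hre him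
  have hα2 : α.im ≤ 0 := by
    by_contra h
    push Not at h
    nlinarith [mul_pos hα h]
  have hβ2 : β.im ≤ 0 := by
    by_contra h
    push Not at h
    nlinarith [mul_pos hβ h, mul_nonneg h0.le hxy]
  have himm : (α * β).im ≤ 0 := by
    rw [Complex.mul_im]
    nlinarith [mul_nonneg hα.le (neg_nonneg.2 hβ2), mul_nonneg hβ.le (neg_nonneg.2 hα2)]
  refine ⟨?_, himm⟩
  rcases hxy.eq_or_lt with h | h
  · have a0 : α.im = 0 := by
      have : α.re * α.im = 0 := by linarith
      exact (mul_eq_zero.1 this).resolve_left hα.ne'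
    rw [Complex.mul_re, a0]
    nlinarith [mul_pos hα hβ]
  · have hneg : -(1 + κ ^ 2) + 2 * κ * (z.re ^ 2 - z.im ^ 2) < 0 := by
      nlinarith [sq_nonneg z.im, mul_pos h0 (sub_pos.2 h1), sq_pos_of_pos (sub_pos.2 h1)]
    by_contra hc
    push Not at hc
    nlinarith [mul_pos h (neg_pos.2 hneg), mul_nonneg (neg_nonneg.2 hc) (neg_nonneg.2 himm)]

lemma vDeriv_quadrant {κ : ℝ} (hκ : κ ∈ Ioo (0 : ℝ) 1) {z : ℂ} (hz : z ∈ slitDom κ)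
    (hre : 0 ≤ z.re) (him : 0 ≤ z.im) (hnorm : ‖z‖ ≤ 1) :
    0 < (vDeriv κ z).re ∧ 0 ≤ (vDeriv κ z).im := by
  obtain ⟨h1, h2⟩ := csqrt_mul_csqrt_quadrant hκ hz hre him hnorm
  have hK := Kell_pos hκ
  rw [vDeriv]
  set w := Complex.sqrt (κ - z ^ 2) * Complex.sqrt (1 - κ * z ^ 2)
  have hw : w ≠ 0 := by
    intro h
    rw [h] at h1
    simp at h1
  have hn : 0 < Complex.normSq w := Complex.normSq_pos.2 hw
  have e : 1 / (((4 * Kell κ : ℝ) : ℂ) * w) = ((1 / (4 * Kell κ) : ℝ) : ℂ) * w⁻¹ := by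
    push_cast
    field_simp
  rw [e, Complex.re_ofReal_mul, Complex.im_ofReal_mul, Complex.inv_re, Complex.inv_im]
  have h2' : 0 ≤ -w.im := by linarith
  constructor <;> positivity

/-- A point of the slit disc is moved to the closed first quadrant by the symmetries
`z ↦ -z` and `z ↦ conj z`. -/
lemma quadrant_induction {p : ℂ → Prop} (hneg : ∀ z, p z → p (-z))
    (hconj : ∀ z, p z → p ((starRingEnd ℂ) z))
    (h : ∀ z : ℂ, 0 ≤ z.re → 0 ≤ z.im → p z) (z : ℂ) : p z := by
  have h1 : ∀ z : ℂ, 0 ≤ z.re → p z := fun z hz => by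
    rcases le_total 0 z.im with hi | hi
    · exact h z hz hi
    · have := hconj _ (h ((starRingEnd ℂ) z) (by simpa using hz) (by simpa using hi))
      simpa using this
  rcases le_total 0 z.re with hr | hr
  · exact h1 z hr
  · have := hneg _ (h1 (-z) (by simpa using hr))
    simpa using this

lemma vDeriv_re_pos {κ : ℝ} (hκ : κ ∈ Ioo (0 : ℝ) 1) (z : ℂ) :
    z ∈ slitDom κ → ‖z‖ ≤ 1 → 0 < (vDeriv κ z).re := by
  refine quadrant_induction (p := fun z => z ∈ slitDom κ → ‖z‖ ≤ 1 → 0 < (vDeriv κ z).re)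
    (fun z h hz hn => ?_) (fun z h hz hn => ?_) (fun z hr hi hz hn => ?_) z
  · rw [vDeriv_neg]
    exact h (by simpa using neg_mem_slitDom hz) (by simpa using hn)
  · have hz' : z ∈ slitDom κ := by simpa using conj_mem_slitDom hz
    rw [vDeriv_conj hκ hz', Complex.conj_re]
    exact h hz' (by simpa using hn)
  · exact (vDeriv_quadrant hκ hz hr hi hn).1

lemma HasDerivAt.complex_re {f : ℝ → ℂ} {f' : ℂ} {t : ℝ} (h : HasDerivAt f f' t) :
    HasDerivAt (fun t => (f t).re) f'.re t :=
  Complex.reCLM.hasFDerivAt.comp_hasDerivAt t h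

lemma HasDerivAt.complex_im {f : ℝ → ℂ} {f' : ℂ} {t : ℝ} (h : HasDerivAt f f' t) :
    HasDerivAt (fun t => (f t).im) f'.im t :=
  Complex.imCLM.hasFDerivAt.comp_hasDerivAt t h

lemma lt_of_hasDerivAt_pos {f f' : ℝ → ℝ} {a b : ℝ} (hab : a < b)
    (h : ∀ t ∈ Icc a b, HasDerivAt f (f' t) t) (hpos : ∀ t ∈ Ioo a b, 0 < f' t) : f a < f b := by
  obtain ⟨c, hc, he⟩ := exists_hasDerivAt_eq_slope f f' hab
    (fun t ht => (h t ht).continuousAt.continuousWithinAt) (fun t ht => h t (Ioo_subset_Icc_self ht))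
  have h1 := hpos c hc
  rw [he] at h1
  have := (div_pos_iff_of_pos_right (sub_pos.2 hab)).1 h1
  linarith

lemma sub_mem_Icc_of_hasDerivAt {f f' : ℝ → ℝ} {a b m M : ℝ} (hab : a ≤ b)
    (h : ∀ t ∈ Icc a b, HasDerivAt f (f' t) t) (hm : ∀ t ∈ Icc a b, f' t ∈ Icc m M) :
    f b - f a ∈ Icc (m * (b - a)) (M * (b - a)) := by
  rcases hab.eq_or_lt with rfl | hab
  · simp
  obtain ⟨c, hc, he⟩ := exists_hasDerivAt_eq_slope f f' hab
    (fun t ht => (h t ht).continuousAt.continuousWithinAt) (fun t ht => h t (Ioo_subset_Icc_self ht))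
  have h1 := hm c (Ioo_subset_Icc_self hc)
  have hb := sub_pos.2 hab
  have e : f b - f a = f' c * (b - a) := by rw [he]; field_simp
  rw [e]
  exact ⟨mul_le_mul_of_nonneg_right h1.1 hb.le, mul_le_mul_of_nonneg_right h1.2 hb.le⟩

lemma hasDerivAt_ofReal_mul (z : ℂ) (t : ℝ) : HasDerivAt (fun t : ℝ => (t : ℂ) * z) z t := by
  simpa using (Complex.ofRealCLM.hasDerivAt (x := t)).mul_const z

section VMap

variable {κ : ℝ} {v : ℂ → ℂ}

lemma IsVmap.hasDerivAt_comp (hv : IsVmap κ v) (hκ : κ ∈ Ioo (0 : ℝ) 1) {γ : ℝ → ℂ} {γ' : ℂ} {t : ℝ}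
    (hγ : HasDerivAt γ γ' t) (hz : γ t ∈ slitDom κ) :
    HasDerivAt (fun t => v (γ t)) (vDeriv κ (γ t) * γ') t :=
  (hv.hasDerivAt hκ hz).comp t hγ

lemma IsVmap.eq_integral (hv : IsVmap κ v) (hκ : κ ∈ Ioo (0 : ℝ) 1) {z : ℂ} (hz : z ∈ slitDom κ) :
    v z = ∫ t in (0:ℝ)..1, vDeriv κ (t * z) * z := by
  have hmem : ∀ t ∈ uIcc (0 : ℝ) 1, (t : ℂ) * z ∈ slitDom κ := fun t ht => by
    rw [uIcc_of_le zero_le_one] at ht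
    exact ofReal_mul_mem_slitDom hκ.1 hz ht
  rw [intervalIntegral.integral_eq_sub_of_hasDerivAt
    (fun t ht => hv.hasDerivAt_comp hκ (hasDerivAt_ofReal_mul z t) (hmem t ht))]
  · simp [hv.map_zero]
  · apply ContinuousOn.intervalIntegrable
    refine ContinuousOn.mul ?_ continuousOn_const
    exact (analyticOnNhd_vDeriv hκ).continuousOn.comp (by fun_prop) hmem

lemma IsVmap.map_neg (hv : IsVmap κ v) (hκ : κ ∈ Ioo (0 : ℝ) 1) {z : ℂ} (hz : z ∈ slitDom κ) :
    v (-z) = - v z := by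
  rw [hv.eq_integral hκ hz, hv.eq_integral hκ (neg_mem_slitDom hz), ← intervalIntegral.integral_neg]
  simp only [mul_neg, vDeriv_neg]

lemma IsVmap.map_conj (hv : IsVmap κ v) (hκ : κ ∈ Ioo (0 : ℝ) 1) {z : ℂ} (hz : z ∈ slitDom κ) :
    v ((starRingEnd ℂ) z) = (starRingEnd ℂ) (v z) := by
  rw [hv.eq_integral hκ hz, hv.eq_integral hκ (conj_mem_slitDom hz),
    ← intervalIntegral.intervalIntegral_conj]
  apply intervalIntegral.integral_congr
  intro t ht
  rw [uIcc_of_le zero_le_one] at ht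
  have := vDeriv_conj hκ (ofReal_mul_mem_slitDom hκ.1 hz ht)
  simp only [map_mul, Complex.conj_ofReal] at this ⊢
  rw [this]

lemma IsVmap.im_eq_zero (hv : IsVmap κ v) (hκ : κ ∈ Ioo (0 : ℝ) 1) {z : ℂ} (hz : z ∈ slitDom κ)
    (h : z.im = 0) : (v z).im = 0 := by
  have h1 := hv.map_conj hκ hz
  rw [Complex.conj_eq_iff_im.2 h] at h1
  exact Complex.conj_eq_iff_im.1 h1.symm

lemma IsVmap.re_eq_zero (hv : IsVmap κ v) (hκ : κ ∈ Ioo (0 : ℝ) 1) {z : ℂ} (hz : z ∈ slitDom κ)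
    (h : z.re = 0) : (v z).re = 0 := by
  have h1 := hv.map_conj hκ hz
  have e : (starRingEnd ℂ) z = -z := by
    apply Complex.ext <;> simp [h]
  rw [e, hv.map_neg hκ hz] at h1
  have := congrArg Complex.re h1
  simp at this
  linarith

lemma norm_sq_eq (z : ℂ) : ‖z‖ ^ 2 = z.re ^ 2 + z.im ^ 2 := by
  rw [Complex.sq_norm, Complex.normSq_apply]; ring

lemma IsVmap.re_nonneg (hv : IsVmap κ v) (hκ : κ ∈ Ioo (0 : ℝ) 1) {z : ℂ} (hz : z ∈ slitDom κ)
    (hn : ‖z‖ ≤ 1) (hre : 0 ≤ z.re) : 0 ≤ (v z).re := by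
  let γ : ℝ → ℂ := fun t => (t : ℂ) * (z.re : ℂ) + z.im * Complex.I
  have hγre : ∀ t, (γ t).re = t * z.re := fun t => by simp [γ]
  have hγim : ∀ t, (γ t).im = z.im := fun t => by simp [γ]
  have hγ : ∀ t, HasDerivAt γ (z.re : ℂ) t := fun t => (hasDerivAt_ofReal_mul _ t).add_const _
  have hle : ∀ t ∈ Icc (0 : ℝ) 1, (t * z.re) ^ 2 ≤ z.re ^ 2 := fun t ht => by
    have : t * z.re ≤ z.re := by nlinarith [ht.2]
    have : 0 ≤ t * z.re := mul_nonneg ht.1 hre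
    gcongr
  have hslit : ∀ t ∈ Icc (0 : ℝ) 1, γ t ∈ slitDom κ := fun t ht h => by
    rw [hγim, hγre] at h
    exact hz ⟨h.1, h.2.trans (hle t ht)⟩
  have hnorm : ∀ t ∈ Icc (0 : ℝ) 1, ‖γ t‖ ≤ 1 := fun t ht => by
    have h1 : ‖γ t‖ ^ 2 ≤ ‖z‖ ^ 2 := by
      rw [norm_sq_eq, norm_sq_eq, hγre, hγim]
      linarith [hle t ht]
    exact ((sq_le_sq₀ (norm_nonneg _) (norm_nonneg _)).1 h1).trans hn
  have h1 : γ 1 = z := by apply Complex.ext <;> simp [γ]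
  have h0 : (v (γ 0)).re = 0 := hv.re_eq_zero hκ (hslit 0 (by simp)) (by rw [hγre]; ring)
  have hm : MonotoneOn (fun t => (v (γ t)).re) (Icc 0 1) := by
    refine monotoneOn_of_hasDerivWithinAt_nonneg
      (f' := fun t => (vDeriv κ (γ t) * (z.re : ℂ)).re) (convex_Icc 0 1) ?_ ?_ ?_
    · exact fun t ht =>
        (hv.hasDerivAt_comp hκ (hγ t) (hslit t ht)).complex_re.continuousAt.continuousWithinAt
    · exact fun t ht => ((hv.hasDerivAt_comp hκ (hγ t)
        (hslit t (interior_subset ht))).complex_re).hasDerivWithinAt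
    · intro t ht
      rw [Complex.re_mul_ofReal]
      exact mul_nonneg (vDeriv_re_pos hκ _ (hslit t (interior_subset ht))
        (hnorm t (interior_subset ht))).le hre
  have := hm (left_mem_Icc.2 zero_le_one) (right_mem_Icc.2 zero_le_one) zero_le_one
  simpa [h0, h1] using this

lemma im_mul_vDeriv_pos (hκ : κ ∈ Ioo (0 : ℝ) 1) {z : ℂ} (hn : ‖z‖ ≤ 1) (hre : 0 ≤ z.re)
    (him : 0 < z.im) : 0 < (vDeriv κ z * z).im := by
  obtain ⟨h1, h2⟩ := vDeriv_quadrant hκ (mem_slitDom_of_im_ne him.ne') hre him.le hn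
  rw [Complex.mul_im]
  have := mul_nonneg h2 hre
  have := mul_pos h1 him
  linarith

lemma IsVmap.im_lt_im_ofReal_mul (hv : IsVmap κ v) (hκ : κ ∈ Ioo (0 : ℝ) 1) {z : ℂ}
    (hre : 0 ≤ z.re) (him : 0 < z.im) {a b : ℝ} (ha : 0 ≤ a) (hab : a < b) (hb : b * ‖z‖ ≤ 1) :
    (v (a * z)).im < (v (b * z)).im := by
  have hslit : ∀ t : ℝ, 0 ≤ t → (t : ℂ) * z ∈ slitDom κ := fun t ht => by
    rcases ht.eq_or_lt with rfl | ht
    · simpa using zero_mem_slitDom hκ.1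
    · exact mem_slitDom_of_im_ne (by rw [Complex.im_ofReal_mul]; positivity)
  refine lt_of_hasDerivAt_pos (f := fun t : ℝ => (v (t * z)).im)
    (f' := fun t : ℝ => (vDeriv κ (t * z) * z).im) hab (fun t ht => ?_) (fun t ht => ?_)
  · exact (hv.hasDerivAt_comp hκ (hasDerivAt_ofReal_mul z t) (hslit t (ha.trans ht.1))).complex_im
  · have ht0 : 0 < t := ha.trans_lt ht.1
    have h := im_mul_vDeriv_pos hκ (z := t * z)
      (by
        rw [norm_mul, Complex.norm_of_nonneg ht0.le]
        exact (mul_le_mul_of_nonneg_right ht.2.le (norm_nonneg z)).trans hb)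
      (by rw [Complex.re_ofReal_mul]; positivity) (by rw [Complex.im_ofReal_mul]; positivity)
    have e : vDeriv κ (t * z) * (t * z) = (t : ℂ) * (vDeriv κ (t * z) * z) := by ring
    rw [e, Complex.im_ofReal_mul] at h
    exact (pos_iff_pos_of_mul_pos h).1 ht0

lemma IsVmap.im_pos_of_quadrant (hv : IsVmap κ v) (hκ : κ ∈ Ioo (0 : ℝ) 1) {z : ℂ}
    (hn : ‖z‖ ≤ 1) (hre : 0 ≤ z.re) (him : 0 < z.im) : 0 < (v z).im := by
  have := hv.im_lt_im_ofReal_mul hκ hre him le_rfl zero_lt_one (by simpa using hn)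
  simpa [hv.map_zero] using this

lemma IsVmap.im_map_I (hv : IsVmap κ v) (hκ : κ ∈ Ioo (0 : ℝ) 1) :
    (v Complex.I).im = Tell κ / 2 := by
  have hκ0 := hκ.1
  have hK := Kell_pos hκ
  rw [hv.eq_integral hκ (mem_slitDom_of_im_ne (by simp))]
  have e : ∀ t : ℝ, vDeriv κ (t * Complex.I) * Complex.I
      = ((1 / (4 * Kell κ) * (1 / Real.sqrt ((κ + t ^ 2) * (1 + κ * t ^ 2))) : ℝ) : ℂ)
        * Complex.I := fun t => by
    have e1 : (κ : ℂ) - (t * Complex.I) ^ 2 = ((κ + t ^ 2 : ℝ) : ℂ) := by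
      rw [mul_pow, Complex.I_sq]; push_cast; ring
    have e2 : 1 - (κ : ℂ) * (t * Complex.I) ^ 2 = ((1 + κ * t ^ 2 : ℝ) : ℂ) := by
      rw [mul_pow, Complex.I_sq]; push_cast; ring
    have p1 : 0 < κ + t ^ 2 := by positivity
    have p2 : 0 < 1 + κ * t ^ 2 := by positivity
    rw [vDeriv, e1, e2, csqrt_ofReal p1, csqrt_ofReal p2, Real.sqrt_mul p1.le]
    push_cast
    field_simp
  simp_rw [e]
  rw [intervalIntegral.integral_mul_const, intervalIntegral.integral_ofReal,
    intervalIntegral.integral_const_mul, integral_imag_axis hκ, Complex.im_ofReal_mul, Tell]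
  simp
  field_simp

lemma re_mul_vDeriv_of_norm_eq_one (hκ : κ ∈ Ioo (0 : ℝ) 1) {z : ℂ} (hn : ‖z‖ = 1)
    (hre : 0 ≤ z.re) (him : 0 < z.im) : (vDeriv κ z * z).re = 0 := by
  have hpos := im_mul_vDeriv_pos hκ hn.le hre him
  have hz := mem_slitDom_of_im_ne (κ := κ) him.ne'
  have ha := slitPlane_ne_zero (mem_slitPlane_left hκ hz)
  have hK := Kell_pos hκ
  have hz0 : z ≠ 0 := by rintro rfl; simp at hn
  have hzz : z * (starRingEnd ℂ) z = 1 := by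
    rw [Complex.mul_conj, Complex.normSq_eq_norm_sq, hn]; simp
  have hb : 1 - (κ : ℂ) * z ^ 2 = - (z ^ 2 * (starRingEnd ℂ) ((κ : ℂ) - z ^ 2)) := by
    rw [map_sub, map_pow, Complex.conj_ofReal]
    linear_combination (1 + z * (starRingEnd ℂ) z) * (-hzz)
  have hsq : (vDeriv κ z * z) ^ 2
      = ((-1 / ((4 * Kell κ) ^ 2 * Complex.normSq ((κ : ℂ) - z ^ 2)) : ℝ) : ℂ) := by
    rw [vDeriv, mul_pow, div_pow, mul_pow, mul_pow, csqrt_sq, csqrt_sq, hb]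
    push_cast
    rw [← Complex.mul_conj]
    have hca : (starRingEnd ℂ) ((κ : ℂ) - z ^ 2) ≠ 0 := (map_ne_zero _).2 ha
    have hKc : (Kell κ : ℂ) ≠ 0 := by exact_mod_cast hK.ne'
    field_simp
  have h2 := two_mul_re_mul_im (vDeriv κ z * z)
  rw [hsq, Complex.ofReal_im] at h2
  have := (mul_eq_zero.1 h2).resolve_right hpos.ne'
  linarith

lemma IsVmap.im_of_norm_eq_one (hv : IsVmap κ v) (hκ : κ ∈ Ioo (0 : ℝ) 1) {z : ℂ} (hn : ‖z‖ = 1)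
    (hre : 0 ≤ z.re) (him : 0 < z.im) : (v z).im = Tell κ / 2 := by
  let γ : ℝ → ℂ := fun θ => Complex.exp (θ * Complex.I)
  have hγ : ∀ θ, HasDerivAt γ (γ θ * Complex.I) θ := fun θ =>
    (hasDerivAt_ofReal_mul Complex.I θ).cexp
  have hγn : ∀ θ, ‖γ θ‖ = 1 := fun θ => Complex.norm_exp_ofReal_mul_I θ
  have h0 : 0 < z.arg := by
    have h1 : z.arg ≠ 0 := fun h => him.ne' (Complex.arg_eq_zero_iff.1 h).2
    exact lt_of_le_of_ne (Complex.arg_nonneg_iff.2 him.le) h1.symm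
  have h1 : z.arg ≤ π / 2 := (abs_le.1 (Complex.abs_arg_le_pi_div_two_iff.2 hre)).2
  have hγz : γ z.arg = z := by
    have := Complex.norm_mul_exp_arg_mul_I z
    rwa [hn, Complex.ofReal_one, one_mul] at this
  have hγI : γ (π / 2) = Complex.I := by
    simp only [γ]
    push_cast
    exact Complex.exp_pi_div_two_mul_I
  have hγre : ∀ θ ∈ Icc z.arg (π / 2), 0 ≤ (γ θ).re := fun θ hθ => by
    simp only [γ, Complex.exp_ofReal_mul_I_re]
    exact Real.cos_nonneg_of_mem_Icc ⟨by linarith [hθ.1, Real.pi_pos], hθ.2⟩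
  have hγim : ∀ θ ∈ Icc z.arg (π / 2), 0 < (γ θ).im := fun θ hθ => by
    simp only [γ, Complex.exp_ofReal_mul_I_im]
    exact Real.sin_pos_of_pos_of_lt_pi (by linarith [hθ.1]) (by linarith [hθ.2, Real.pi_pos])
  have h := sub_mem_Icc_of_hasDerivAt (m := 0) (M := 0) (f := fun θ => (v (γ θ)).im) h1
    (fun θ hθ => (hv.hasDerivAt_comp hκ (hγ θ)
      (mem_slitDom_of_im_ne (hγim θ hθ).ne')).complex_im) (fun θ hθ => by
        have := re_mul_vDeriv_of_norm_eq_one hκ (hγn θ) (hγre θ hθ) (hγim θ hθ)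
        rw [← mul_assoc, Complex.mul_I_im, this]
        simp)
  simp only [zero_mul, hγz, hγI, hv.im_map_I hκ] at h
  linarith [h.1, h.2]

lemma Tell_pos (hκ : κ ∈ Ioo (0 : ℝ) 1) : 0 < Tell κ := by
  have := Kell_pos hκ
  have := Kell_pos (kComp_mem hκ)
  rw [Tell]
  positivity

lemma IsVmap.im_lt (hv : IsVmap κ v) (hκ : κ ∈ Ioo (0 : ℝ) 1) {z : ℂ} (hz : z ∈ slitDom κ)
    (hn : ‖z‖ < 1) (hre : 0 ≤ z.re) (him : 0 ≤ z.im) : (v z).im < Tell κ / 2 := by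
  have hT := Tell_pos hκ
  rcases him.eq_or_lt with h | h
  · rw [hv.im_eq_zero hκ hz h.symm]
    positivity
  · have hz0 : 0 < ‖z‖ := norm_pos_iff.2 (by rintro rfl; simp at h)
    have h1 := hv.im_lt_im_ofReal_mul hκ hre h zero_le_one ((one_lt_inv₀ hz0).2 hn)
      (inv_mul_cancel₀ hz0.ne').le
    have h2 : (v ((‖z‖⁻¹ : ℝ) * z)).im = Tell κ / 2 := by
      refine hv.im_of_norm_eq_one hκ ?_ ?_ ?_
      · rw [norm_mul, Complex.norm_of_nonneg (by positivity), inv_mul_cancel₀ hz0.ne']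
      · rw [Complex.re_ofReal_mul]; positivity
      · rw [Complex.im_ofReal_mul]; positivity
    rw [h2] at h1
    simpa using h1

end VMap

/-- The real part of `v_κ` at `√κ * s`. -/
def axisRe (κ s : ℝ) : ℝ :=
  (∫ y in (0:ℝ)..s, 1 / Real.sqrt ((1 - y ^ 2) * (1 - κ ^ 2 * y ^ 2))) / (4 * Kell κ)

section Confocal

variable {κ : ℝ} {v : ℂ → ℂ}

lemma axisRe_one (hκ : κ ∈ Ioo (0 : ℝ) 1) : axisRe κ 1 = 1 / 4 := by
  have := Kell_pos hκ
  rw [axisRe, ← Kell]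
  field_simp

lemma continuousOn_axisRe (hκ : κ ∈ Ioo (0 : ℝ) 1) : ContinuousOn (axisRe κ) (Icc 0 1) := by
  have h := intervalIntegral.continuousOn_primitive_interval' (Kell_integrable hκ)
    (left_mem_uIcc (a := (0 : ℝ)) (b := 1))
  rw [uIcc_of_le zero_le_one] at h
  exact h.div_const _

lemma axisRe_lt (hκ : κ ∈ Ioo (0 : ℝ) 1) {s : ℝ} (hs : s ∈ Ico (0 : ℝ) 1) :
    axisRe κ s < 1 / 4 := by
  have hK := Kell_pos hκ
  have hi := Kell_integrable hκ
  have h1 : IntervalIntegrable (fun y : ℝ => 1 / Real.sqrt ((1 - y ^ 2) * (1 - κ ^ 2 * y ^ 2)))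
      MeasureTheory.volume 0 s := hi.mono_set (by
    rw [uIcc_of_le hs.1, uIcc_of_le zero_le_one]; exact Icc_subset_Icc_right hs.2.le)
  have h2 : IntervalIntegrable (fun y : ℝ => 1 / Real.sqrt ((1 - y ^ 2) * (1 - κ ^ 2 * y ^ 2)))
      MeasureTheory.volume s 1 := hi.mono_set (by
    rw [uIcc_of_le hs.2.le, uIcc_of_le zero_le_one]; exact Icc_subset_Icc_left hs.1)
  have h3 := intervalIntegral.intervalIntegral_pos_of_pos_on h2 (fun y hy => by
    have hy0 : 0 ≤ y := hs.1.trans hy.1.le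
    have hy1 : y ^ 2 < 1 := by nlinarith [hy.2]
    have hk1 : κ ^ 2 < 1 := by nlinarith [hκ.1, hκ.2]
    have : κ ^ 2 * y ^ 2 < 1 := by nlinarith [sq_nonneg y]
    exact one_div_pos.2 (Real.sqrt_pos.2 (mul_pos (by linarith) (by linarith)))) hs.2
  rw [← axisRe_one hκ, axisRe, axisRe, ← intervalIntegral.integral_add_adjacent_intervals h1 h2]
  gcongr
  linarith

lemma IsVmap.re_axis (hv : IsVmap κ v) (hκ : κ ∈ Ioo (0 : ℝ) 1) {s : ℝ} (hs : s ∈ Ico (0 : ℝ) 1) :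
    (v ((s : ℂ) * Real.sqrt κ)).re = axisRe κ s := by
  have hK := Kell_pos hκ
  have hκ0 := hκ.1
  have h1 : IntervalIntegrable (fun y : ℝ => 1 / Real.sqrt ((1 - y ^ 2) * (1 - κ ^ 2 * y ^ 2)))
      MeasureTheory.volume 0 s := (Kell_integrable hκ).mono_set (by
    rw [uIcc_of_le hs.1, uIcc_of_le zero_le_one]; exact Icc_subset_Icc_right hs.2.le)
  have h := intervalIntegral.integral_eq_sub_of_hasDerivAt
    (f := fun t : ℝ => (v ((t : ℂ) * Real.sqrt κ)).re * (4 * Kell κ)) (fun t ht => ?_) h1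
  · simp only [Complex.ofReal_zero, zero_mul, hv.map_zero, Complex.zero_re, sub_zero] at h
    rw [axisRe, h]
    field_simp
  · rw [uIcc_of_le hs.1] at ht
    have ht1 : t ^ 2 < 1 := by nlinarith [ht.1, ht.2, hs.2]
    have hlt : (t * Real.sqrt κ) ^ 2 < κ := by
      rw [mul_pow, Real.sq_sqrt hκ0.le]; nlinarith
    have hmem : (t : ℂ) * Real.sqrt κ ∈ slitDom κ := by
      have := ofReal_mem_slitDom.2 hlt
      simpa using this
    refine (((hv.hasDerivAt_comp hκ (hasDerivAt_ofReal_mul (Real.sqrt κ : ℂ) t)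
      hmem).complex_re).mul_const (4 * Kell κ)).congr_deriv ?_
    rw [← Complex.ofReal_mul, vDeriv_ofReal hκ hlt, ← Complex.ofReal_mul, Complex.ofReal_re,
      mul_pow, Real.sq_sqrt hκ0.le,
      show (κ - t ^ 2 * κ) * (1 - κ * (t ^ 2 * κ)) = κ * ((1 - t ^ 2) * (1 - κ ^ 2 * t ^ 2)) by ring,
      Real.sqrt_mul hκ0.le]
    have := Real.sqrt_pos.2 hκ0
    have hne : Real.sqrt ((1 - t ^ 2) * (1 - κ ^ 2 * t ^ 2)) ≠ 0 := by
      have hk1 : κ ^ 2 < 1 := by nlinarith [hκ.1, hκ.2]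
      have : κ ^ 2 * t ^ 2 < 1 := by nlinarith [sq_nonneg t]
      exact (Real.sqrt_pos.2 (mul_pos (by linarith) (by linarith))).ne'
    field_simp

/-- The square of the first coordinate of `z` in the elliptic coordinates
`z = √κ * (p * cosh t + i * √(1 - p²) * sinh t)` with foci `±√κ`. -/
def confocal (κ : ℝ) (z : ℂ) : ℝ := (κ + ‖z‖ ^ 2 - ‖(κ : ℂ) - z ^ 2‖) / (2 * κ)

lemma continuous_confocal (κ : ℝ) : Continuous (confocal κ) := by
  unfold confocal
  fun_prop

lemma confocal_neg (z : ℂ) : confocal κ (-z) = confocal κ z := by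
  simp [confocal]

lemma confocal_conj (z : ℂ) : confocal κ ((starRingEnd ℂ) z) = confocal κ z := by
  rw [confocal, ← map_pow, ← Complex.conj_ofReal κ, ← map_sub, RCLike.norm_conj, RCLike.norm_conj,
    confocal]

lemma norm_sub_sq_sq (z : ℂ) :
    ‖(κ : ℂ) - z ^ 2‖ ^ 2 = (κ + ‖z‖ ^ 2) ^ 2 - 4 * κ * z.re ^ 2 := by
  have h1 := re_sub_sq κ 1 z
  have h2 := im_sub_sq κ 1 z
  rw [Complex.ofReal_one, one_mul] at h1 h2
  rw [norm_sq_eq, norm_sq_eq, h1, h2]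
  ring

lemma confocal_nonneg (hκ : 0 < κ) (z : ℂ) : 0 ≤ confocal κ z := by
  have h := norm_sub_sq_sq (κ := κ) z
  have h1 : ‖(κ : ℂ) - z ^ 2‖ ≤ κ + ‖z‖ ^ 2 :=
    le_of_sq_le_sq (by nlinarith [mul_nonneg hκ.le (sq_nonneg z.re)]) (by positivity)
  rw [confocal]
  exact div_nonneg (by linarith) (by positivity)

lemma confocal_le (hκ : 0 < κ) (z : ℂ) : confocal κ z ≤ ‖z‖ ^ 2 / κ := by
  have h := norm_sub_sq_sq (κ := κ) z
  have h2 := norm_sq_eq z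
  have h1 : κ - ‖z‖ ^ 2 ≤ ‖(κ : ℂ) - z ^ 2‖ :=
    le_of_sq_le_sq (by rw [h, h2]; nlinarith [mul_nonneg hκ.le (sq_nonneg z.im)]) (norm_nonneg _)
  rw [confocal, div_le_div_iff₀ (by positivity) hκ]
  nlinarith

lemma confocal_lt_one (hκ : 0 < κ) {z : ℂ} (hz : z ∈ slitDom κ) : confocal κ z < 1 := by
  have h := norm_sub_sq_sq (κ := κ) z
  have h2 := norm_sq_eq z
  have h1 : ‖z‖ ^ 2 - κ < ‖(κ : ℂ) - z ^ 2‖ := by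
    by_cases him : z.im = 0
    · have : z.re ^ 2 < κ := by
        by_contra! h'
        exact hz ⟨him, h'⟩
      rw [him] at h2
      linarith [norm_nonneg ((κ : ℂ) - z ^ 2)]
    · have : 0 < κ * z.im ^ 2 := by positivity
      refine lt_of_pow_lt_pow_left₀ 2 (norm_nonneg _) ?_
      rw [h, h2]
      nlinarith
  rw [confocal, div_lt_one (by positivity)]
  linarith

lemma confocal_eq_one (hκ : 0 < κ) {z : ℂ} (hz : z ∉ slitDom κ) : confocal κ z = 1 := by
  obtain ⟨h1, h2⟩ := not_not.1 hz
  have h3 := norm_sq_eq z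
  rw [h1] at h3
  have h : ‖(κ : ℂ) - z ^ 2‖ ^ 2 = (z.re ^ 2 - κ) ^ 2 := by
    rw [norm_sub_sq_sq, h3]; ring
  have h4 := (sq_eq_sq₀ (norm_nonneg _) (sub_nonneg.2 h2)).1 h
  rw [confocal, h4, h3]
  field_simp
  ring

lemma confocal_mul_add (hκ : 0 < κ) (z : ℂ) :
    confocal κ z * (1 + (‖z‖ ^ 2 / κ - confocal κ z)) = z.re ^ 2 / κ := by
  have h := norm_sub_sq_sq (κ := κ) z
  rw [confocal]
  field_simp
  linear_combination -h

lemma one_sub_confocal_mul (hκ : 0 < κ) (z : ℂ) :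
    (1 - confocal κ z) * (‖z‖ ^ 2 / κ - confocal κ z) = z.im ^ 2 / κ := by
  have h := confocal_mul_add hκ z
  have h2 : z.im ^ 2 / κ = ‖z‖ ^ 2 / κ - z.re ^ 2 / κ := by rw [norm_sq_eq]; ring
  rw [h2]
  linear_combination -h

/-- A point of the hyperbola with foci `±√κ` and semi-axes `p * √κ`, `q * √κ`. -/
def hyperbola (κ p q t : ℝ) : ℂ :=
  Real.sqrt κ * (p * Real.cosh t + q * Real.sinh t * Complex.I)

lemma hyperbola_re (κ p q t : ℝ) : (hyperbola κ p q t).re = Real.sqrt κ * (p * Real.cosh t) := by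
  rw [hyperbola, Complex.re_ofReal_mul, ← Complex.ofReal_mul, ← Complex.ofReal_mul]
  simp

lemma hyperbola_im (κ p q t : ℝ) : (hyperbola κ p q t).im = Real.sqrt κ * (q * Real.sinh t) := by
  rw [hyperbola, Complex.im_ofReal_mul, ← Complex.ofReal_mul, ← Complex.ofReal_mul, Complex.add_im,
    Complex.ofReal_im, Complex.mul_I_im, Complex.ofReal_re, zero_add]

lemma hasDerivAt_hyperbola (κ p q t : ℝ) : HasDerivAt (hyperbola κ p q)
    (Real.sqrt κ * (p * Real.sinh t + q * Real.cosh t * Complex.I)) t := by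
  have hc := (Real.hasDerivAt_cosh t).ofReal_comp
  have hs := (Real.hasDerivAt_sinh t).ofReal_comp
  exact ((hc.const_mul (p : ℂ)).add ((hs.const_mul (q : ℂ)).mul_const Complex.I)).const_mul _

lemma norm_hyperbola_sq (hκ : 0 < κ) {p q : ℝ} (hpq : p ^ 2 + q ^ 2 = 1) (t : ℝ) :
    ‖hyperbola κ p q t‖ ^ 2 = κ * (p ^ 2 + Real.sinh t ^ 2) := by
  rw [norm_sq_eq, hyperbola_re, hyperbola_im]
  linear_combination ((p * Real.cosh t) ^ 2 + (q * Real.sinh t) ^ 2) * Real.sq_sqrt hκ.le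
    + κ * p ^ 2 * Real.cosh_sq t + κ * Real.sinh t ^ 2 * hpq

lemma sub_hyperbola_sq (hκ : 0 < κ) {p q : ℝ} (hpq : p ^ 2 + q ^ 2 = 1) (t : ℝ) :
    (κ : ℂ) - hyperbola κ p q t ^ 2
      = (Real.sqrt κ * (q * Real.cosh t - p * Real.sinh t * Complex.I)) ^ 2 := by
  have hpq' : (p : ℂ) ^ 2 + (q : ℂ) ^ 2 = 1 := by exact_mod_cast hpq
  have hc : (Real.cosh t : ℂ) ^ 2 = (Real.sinh t : ℂ) ^ 2 + 1 := by exact_mod_cast Real.cosh_sq t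
  have hk : (Real.sqrt κ : ℂ) ^ 2 = κ := by exact_mod_cast Real.sq_sqrt hκ.le
  rw [hyperbola, mul_pow, mul_pow, hk]
  linear_combination (-κ * (Real.cosh t : ℂ) ^ 2) * hpq' - κ * hc -
    κ * Real.sinh t ^ 2 * (p ^ 2 + q ^ 2) * Complex.I_sq + κ * Real.sinh t ^ 2 * hpq'

lemma hyperbola_mem_slitDom (hκ : 0 < κ) {p q t : ℝ} (hq : 0 < q) (hpq : p ^ 2 + q ^ 2 = 1) :
    hyperbola κ p q t ∈ slitDom κ := by
  rintro ⟨h1, h2⟩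
  rw [hyperbola_im] at h1
  have hs : Real.sinh t = 0 := by
    have := (Real.sqrt_pos.2 hκ).ne'
    simpa [this, hq.ne'] using h1
  rw [Real.sinh_eq_zero] at hs
  rw [hyperbola_re, hs, Real.cosh_zero, mul_one, mul_pow, Real.sq_sqrt hκ.le] at h2
  nlinarith [mul_pos hκ (pow_pos hq 2)]

/-- Along a confocal hyperbola the real part of `v_κ` changes slowly. -/
lemma re_vDeriv_hyperbola_mem (hκ : κ ∈ Ioo (0 : ℝ) 1) {p q t : ℝ} (hp : 0 ≤ p) (hq : 0 < q)
    (hpq : p ^ 2 + q ^ 2 = 1) (ht : 0 ≤ t) (hn : ‖hyperbola κ p q t‖ ≤ 1) :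
    (vDeriv κ (hyperbola κ p q t) *
      (Real.sqrt κ * (p * Real.sinh t + q * Real.cosh t * Complex.I))).re ∈
      Icc (-((hyperbola κ p q t).im / (4 * Kell κ * (1 - κ) ^ 2))) 0 := by
  obtain ⟨hκ0, hκ1⟩ := hκ
  have hK := Kell_pos ⟨hκ0, hκ1⟩
  have hk := Real.sqrt_pos.2 hκ0
  set z := hyperbola κ p q t with hzdef
  have hz : z ∈ slitDom κ := hyperbola_mem_slitDom hκ0 hq hpq
  have hre : 0 ≤ z.re := by
    rw [hzdef, hyperbola_re]
    have := Real.cosh_pos t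
    positivity
  have him : 0 ≤ z.im := by
    rw [hzdef, hyperbola_im]
    have := Real.sinh_nonneg_iff.2 ht
    positivity
  have hn2 : z.re ^ 2 + z.im ^ 2 ≤ 1 := by
    rw [← norm_sq_eq]
    exact pow_le_one₀ (norm_nonneg _) hn
  set c : ℂ := q * Real.cosh t - p * Real.sinh t * Complex.I with hc
  have hcre : 0 < (Real.sqrt κ * c).re := by
    rw [Complex.re_ofReal_mul, hc, ← Complex.ofReal_mul, ← Complex.ofReal_mul]
    have := Real.cosh_pos t
    have := mul_pos hq this
    simpa using mul_pos hk this
  have hα : Complex.sqrt ((κ : ℂ) - z ^ 2) = Real.sqrt κ * c := by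
    rw [hzdef, sub_hyperbola_sq hκ0 hpq, csqrt_sq_of_re_pos hcre]
  have hc0 : (Real.sqrt κ : ℂ) * c ≠ 0 := fun h => by rw [h] at hcre; simp at hcre
  have hb := mem_slitPlane_right ⟨hκ0, hκ1⟩ hz
  set β := Complex.sqrt (1 - (κ : ℂ) * z ^ 2) with hβ
  have hβre : 0 < β.re := csqrt_re_pos hb
  have hβ0 : β ≠ 0 := csqrt_ne_zero hb
  have hβ2 : β ^ 2 = 1 - (κ : ℂ) * z ^ 2 := csqrt_sq _
  have h1 := re_sub_sq 1 κ z
  have h2 := im_sub_sq 1 κ z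
  rw [Complex.ofReal_one, ← hβ2, pow_two, Complex.mul_re] at h1
  rw [Complex.ofReal_one, ← hβ2, pow_two, Complex.mul_im] at h2
  have e : vDeriv κ z * (Real.sqrt κ * (p * Real.sinh t + q * Real.cosh t * Complex.I))
      = Complex.I / β / (4 * Kell κ : ℝ) := by
    have e' : (p * Real.sinh t + q * Real.cosh t * Complex.I : ℂ) = Complex.I * c := by
      rw [hc]
      linear_combination (p * Real.sinh t : ℂ) * Complex.I_sq
    have hKc : ((4 * Kell κ : ℝ) : ℂ) ≠ 0 := by
      exact_mod_cast (mul_pos four_pos hK).ne'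
    rw [e', vDeriv, hα, ← hβ, mul_left_comm (Real.sqrt κ : ℂ)]
    field_simp [(mul_ne_zero_iff.1 hc0).1, (mul_ne_zero_iff.1 hc0).2]
  rw [e, Complex.div_ofReal_re, Complex.div_re]
  simp only [Complex.I_re, Complex.I_im, zero_mul, zero_div, one_mul, zero_add]
  have hm : 0 < 1 - κ := sub_pos.2 hκ1
  have hβim : β.im ≤ 0 := by nlinarith [mul_nonneg (mul_nonneg hκ0.le hre) him]
  have hβre2 : (1 - κ) ^ 2 ≤ β.re ^ 2 := by
    nlinarith [sq_nonneg β.im, mul_nonneg hκ0.le (sq_nonneg z.im)]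
  have hβre1 : 1 - κ ≤ β.re := le_of_sq_le_sq hβre2 hβre.le
  have hnsq : 1 - κ ≤ Complex.normSq β := by
    rw [Complex.normSq_apply]
    nlinarith [sq_nonneg β.im, mul_nonneg hκ0.le (sq_nonneg z.im)]
  have hns : 0 < Complex.normSq β := hm.trans_le hnsq
  have hx1 : z.re ≤ 1 := by nlinarith [sq_nonneg z.im]
  have hbound : -β.im * (1 - κ) ≤ z.im := by
    have h3 : -β.im * (1 - κ) ≤ -β.im * β.re := by gcongr; linarith
    have h4 : -β.im * β.re = κ * (z.re * z.im) := by linarith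
    have h5 : κ * (z.re * z.im) ≤ 1 * (1 * z.im) := by gcongr
    linarith
  constructor
  · rw [neg_le, ← neg_div, ← neg_div, div_div, div_le_div_iff₀ (by positivity) (by positivity)]
    have : -β.im * (1 - κ) * (1 - κ) ≤ z.im * Complex.normSq β := by gcongr
    nlinarith
  · exact div_nonpos_of_nonpos_of_nonneg (div_nonpos_of_nonpos_of_nonneg hβim hns.le)
      (by positivity)

lemma IsVmap.re_mem_of_quadrant (hv : IsVmap κ v) (hκ : κ ∈ Ioo (0 : ℝ) 1) {z : ℂ}
    (hz : z ∈ slitDom κ) (hn : ‖z‖ ≤ 1) (hre : 0 ≤ z.re) (him : 0 ≤ z.im) :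
    (v z).re ∈ Icc (axisRe κ (Real.sqrt (confocal κ z)) - z.im / (4 * Kell κ * κ * (1 - κ) ^ 2))
      (axisRe κ (Real.sqrt (confocal κ z))) := by
  have hκ0 := hκ.1
  have hκ1 := hκ.2
  have hK := Kell_pos hκ
  have hS0 := confocal_nonneg hκ0 z
  have hS1 := confocal_lt_one hκ0 hz
  have hSM := sub_nonneg.2 (confocal_le hκ0 z)
  have hmul1 := confocal_mul_add hκ0 z
  have hmul2 := one_sub_confocal_mul hκ0 z
  set S := confocal κ z with hS
  set R := ‖z‖ ^ 2 / κ - S with hR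
  set p := Real.sqrt S with hp
  set q := Real.sqrt (1 - S) with hq
  set Y := Real.arsinh (Real.sqrt R) with hY
  have hq0 : 0 < q := Real.sqrt_pos.2 (sub_pos.2 hS1)
  have hp0 : 0 ≤ p := Real.sqrt_nonneg _
  have hp2 : p ^ 2 = S := Real.sq_sqrt hS0
  have hq2 : q ^ 2 = 1 - S := Real.sq_sqrt (sub_pos.2 hS1).le
  have hpq : p ^ 2 + q ^ 2 = 1 := by rw [hp2, hq2]; ring
  have hY0 : 0 ≤ Y := Real.arsinh_nonneg_iff.2 (Real.sqrt_nonneg _)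
  have hsY : Real.sinh Y ^ 2 = R := by rw [hY, Real.sinh_arsinh, Real.sq_sqrt hSM]
  have hsY0 : 0 ≤ Real.sinh Y := Real.sinh_nonneg_iff.2 hY0
  have hkk := Real.sq_sqrt hκ0.le
  have hn2 : ‖z‖ ^ 2 ≤ 1 := pow_le_one₀ (norm_nonneg _) hn
  have hend : hyperbola κ p q Y = z := by
    have hcY := (Real.cosh_pos Y).le
    apply Complex.ext
    · rw [hyperbola_re]
      refine (sq_eq_sq₀ (by positivity) hre).1 ?_
      rw [mul_pow, mul_pow, hkk, Real.cosh_sq, hsY, hp2, add_comm R, hmul1]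
      field_simp
    · rw [hyperbola_im]
      refine (sq_eq_sq₀ (by positivity) him).1 ?_
      rw [mul_pow, mul_pow, hkk, hsY, hq2, hmul2]
      field_simp
  have hstart : hyperbola κ p q 0 = (p : ℂ) * Real.sqrt κ := by
    rw [hyperbola, Real.cosh_zero, Real.sinh_zero]
    push_cast
    ring
  have hsinh : ∀ t ∈ Icc 0 Y, Real.sinh t ≤ Real.sinh Y := fun t ht => Real.sinh_le_sinh.2 ht.2
  have hnorm : ∀ t ∈ Icc 0 Y, ‖hyperbola κ p q t‖ ≤ 1 := fun t ht => by
    refine le_trans (le_of_sq_le_sq ?_ (norm_nonneg z)) hn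
    have h := hsinh t ht
    have h0 := Real.sinh_nonneg_iff.2 ht.1
    rw [norm_hyperbola_sq hκ0 hpq, ← hend, norm_hyperbola_sq hκ0 hpq]
    gcongr
  have him_le : ∀ t ∈ Icc 0 Y, (hyperbola κ p q t).im ≤ z.im := fun t ht => by
    have h := hsinh t ht
    rw [← hend, hyperbola_im, hyperbola_im]
    gcongr
  have h := sub_mem_Icc_of_hasDerivAt (f := fun t => (v (hyperbola κ p q t)).re)
    (m := -(z.im / (4 * Kell κ * (1 - κ) ^ 2))) (M := 0) hY0
    (fun t _ => (hv.hasDerivAt_comp hκ (hasDerivAt_hyperbola κ p q t)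
      (hyperbola_mem_slitDom hκ0 hq0 hpq)).complex_re) (fun t ht => by
        obtain ⟨h1, h2⟩ := re_vDeriv_hyperbola_mem hκ hp0 hq0 hpq ht.1 (hnorm t ht)
        refine ⟨le_trans (neg_le_neg ?_) h1, h2⟩
        gcongr
        exact him_le t ht)
  simp only [hend, hstart, zero_mul, sub_zero] at h
  have hp1 : p < 1 := by
    rw [hp, Real.sqrt_lt' one_pos]
    simpa using hS1
  rw [hv.re_axis hκ ⟨hp0, hp1⟩] at h
  have hYle : Y ≤ 1 / κ := by
    refine (Real.self_le_sinh_iff.2 hY0).trans (le_of_sq_le_sq ?_ (by positivity))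
    have h1 : 1 ≤ 1 / κ := (one_le_div hκ0).2 hκ1.le
    have h2 : R ≤ 1 / κ := by
      have : ‖z‖ ^ 2 / κ ≤ 1 / κ := by gcongr
      rw [hR]
      linarith
    rw [hsY]
    nlinarith
  have hm : 0 < (1 - κ) ^ 2 := pow_pos (sub_pos.2 hκ1) 2
  have h3 : z.im / (4 * Kell κ * (1 - κ) ^ 2) * Y ≤ z.im / (4 * Kell κ * κ * (1 - κ) ^ 2) := by
    calc _ ≤ z.im / (4 * Kell κ * (1 - κ) ^ 2) * (1 / κ) := by gcongr
      _ = _ := by field_simp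
  exact ⟨by linarith [h.1], by linarith [h.2]⟩

end Confocal

lemma injOn_of_re_hasDerivAt_pos {s : Set ℂ} (hs : Convex ℝ s) {f f' : ℂ → ℂ}
    (h : ∀ z ∈ s, HasDerivAt f (f' z) z) (hpos : ∀ z ∈ s, 0 < (f' z).re) : InjOn f s := by
  intro z hz w hw hzw
  by_contra hne
  have hd : w - z ≠ 0 := sub_ne_zero.2 (Ne.symm hne)
  have hγ : ∀ t : ℝ, HasDerivAt (fun t : ℝ => z + (t : ℂ) * (w - z)) (w - z) t := fun t =>
    (hasDerivAt_ofReal_mul _ t).const_add z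
  have hmem : ∀ t ∈ Icc (0 : ℝ) 1, z + (t : ℂ) * (w - z) ∈ s := fun t ht => by
    simpa using hs.add_smul_sub_mem hz hw ht
  have hlt := lt_of_hasDerivAt_pos (f := fun t : ℝ => (f (z + (t : ℂ) * (w - z)) / (w - z)).re)
    (f' := fun t => (f' (z + (t : ℂ) * (w - z))).re) zero_lt_one (fun t ht => by
      have := (((h _ (hmem t ht)).comp t (hγ t)).div_const (w - z)).complex_re
      rwa [mul_div_cancel_right₀ _ hd] at this) (fun t ht => hpos _ (hmem t (Ioo_subset_Icc_self ht)))
  simp [hzw] at hlt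

lemma convex_slitDom_inter_im_nonneg (κ : ℝ) : Convex ℝ (slitDom κ ∩ {z | 0 ≤ z.im}) := by
  rintro z ⟨hz, hz0⟩ w ⟨hw, hw0⟩ a b ha hb hab
  rw [mem_ofPred_eq] at hz0 hw0
  rcases ha.eq_or_lt with rfl | ha'
  · rw [zero_add] at hab
    simpa [hab] using ⟨hw, hw0⟩
  rcases hb.eq_or_lt with rfl | hb'
  · rw [add_zero] at hab
    simpa [hab] using ⟨hz, hz0⟩
  have him : (a • z + b • w).im = a * z.im + b * w.im := by simp
  have hre : (a • z + b • w).re = a * z.re + b * w.re := by simp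
  refine ⟨?_, by rw [mem_ofPred_eq, him]; positivity⟩
  rintro ⟨h1, h2⟩
  rw [him] at h1
  rw [hre] at h2
  have hz1 : z.im = 0 := by
    by_contra h
    have := mul_pos ha' (lt_of_le_of_ne hz0 (Ne.symm h))
    nlinarith
  have hw1 : w.im = 0 := by
    by_contra h
    have := mul_pos hb' (lt_of_le_of_ne hw0 (Ne.symm h))
    nlinarith
  have hz2 : z.re ^ 2 < κ := not_le.1 fun h => hz ⟨hz1, h⟩
  have hw2 : w.re ^ 2 < κ := not_le.1 fun h => hw ⟨hw1, h⟩
  have e : (a * z.re + b * w.re) ^ 2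
      = a * z.re ^ 2 + b * w.re ^ 2 - a * b * (z.re - w.re) ^ 2 := by
    obtain rfl : b = 1 - a := by linarith
    ring
  have := mul_lt_mul_of_pos_left hz2 ha'
  have := mul_lt_mul_of_pos_left hw2 hb'
  have := mul_nonneg (mul_nonneg ha hb) (sq_nonneg (z.re - w.re))
  have : a * κ + b * κ = κ := by rw [← add_mul, hab, one_mul]
  linarith

section VMap

variable {κ : ℝ} {v : ℂ → ℂ}

lemma IsVmap.abs_re_mem (hv : IsVmap κ v) (hκ : κ ∈ Ioo (0 : ℝ) 1) (z : ℂ) :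
    z ∈ slitDom κ → ‖z‖ ≤ 1 → |(v z).re| ∈
      Icc (axisRe κ (Real.sqrt (confocal κ z)) - |z.im| / (4 * Kell κ * κ * (1 - κ) ^ 2))
        (axisRe κ (Real.sqrt (confocal κ z))) := by
  induction z using quadrant_induction with
  | hneg z ih =>
    intro hz hn
    have hz' : z ∈ slitDom κ := by simpa using neg_mem_slitDom hz
    have := ih hz' (by simpa using hn)
    rwa [hv.map_neg hκ hz', confocal_neg, Complex.neg_re, Complex.neg_im, abs_neg, abs_neg]
  | hconj z ih =>
    intro hz hn
    have hz' : z ∈ slitDom κ := by simpa using conj_mem_slitDom hz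
    have := ih hz' (by simpa using hn)
    rwa [hv.map_conj hκ hz', confocal_conj, Complex.conj_re, Complex.conj_im, abs_neg]
  | h z hre him =>
    intro hz hn
    rw [abs_of_nonneg him, abs_of_nonneg (hv.re_nonneg hκ hz hn hre)]
    exact hv.re_mem_of_quadrant hκ hz hn hre him

lemma IsVmap.abs_re_lt (hv : IsVmap κ v) (hκ : κ ∈ Ioo (0 : ℝ) 1) {z : ℂ} (hz : z ∈ slitDom κ)
    (hn : ‖z‖ ≤ 1) : |(v z).re| < 1 / 4 := by
  refine (hv.abs_re_mem hκ z hz hn).2.trans_lt (axisRe_lt hκ ⟨Real.sqrt_nonneg _, ?_⟩)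
  rw [Real.sqrt_lt' one_pos]
  simpa using confocal_lt_one hκ.1 hz

lemma IsVmap.im_mul_im_pos (hv : IsVmap κ v) (hκ : κ ∈ Ioo (0 : ℝ) 1) (z : ℂ) :
    ‖z‖ ≤ 1 → z.im ≠ 0 → 0 < z.im * (v z).im := by
  induction z using quadrant_induction with
  | hneg z ih =>
    intro hn h
    have h' : z.im ≠ 0 := by simpa using h
    rw [hv.map_neg hκ (mem_slitDom_of_im_ne h'), Complex.neg_im, Complex.neg_im, neg_mul_neg]
    exact ih (by simpa using hn) h'
  | hconj z ih =>
    intro hn h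
    have h' : z.im ≠ 0 := by simpa using h
    rw [hv.map_conj hκ (mem_slitDom_of_im_ne h'), Complex.conj_im, Complex.conj_im, neg_mul_neg]
    exact ih (by simpa using hn) h'
  | h z hre him =>
    intro hn h
    have h' := lt_of_le_of_ne him h.symm
    exact mul_pos h' (hv.im_pos_of_quadrant hκ hn hre h')

lemma IsVmap.abs_im_lt (hv : IsVmap κ v) (hκ : κ ∈ Ioo (0 : ℝ) 1) (z : ℂ) :
    z ∈ slitDom κ → ‖z‖ < 1 → |(v z).im| < Tell κ / 2 := by
  induction z using quadrant_induction with
  | hneg z ih =>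
    intro hz hn
    have hz' : z ∈ slitDom κ := by simpa using neg_mem_slitDom hz
    rw [hv.map_neg hκ hz', Complex.neg_im, abs_neg]
    exact ih hz' (by simpa using hn)
  | hconj z ih =>
    intro hz hn
    have hz' : z ∈ slitDom κ := by simpa using conj_mem_slitDom hz
    rw [hv.map_conj hκ hz', Complex.conj_im, abs_neg]
    exact ih hz' (by simpa using hn)
  | h z hre him =>
    intro hz hn
    have h0 : 0 ≤ (v z).im := by
      rcases him.eq_or_lt with h | h
      · exact (hv.im_eq_zero hκ hz h.symm).ge
      · exact (hv.im_pos_of_quadrant hκ hn.le hre h).le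
    rw [abs_of_nonneg h0]
    exact hv.im_lt hκ hz hn hre him

lemma IsVmap.abs_im_of_norm_eq_one (hv : IsVmap κ v) (hκ : κ ∈ Ioo (0 : ℝ) 1) (z : ℂ) :
    ‖z‖ = 1 → z.im ≠ 0 → |(v z).im| = Tell κ / 2 := by
  induction z using quadrant_induction with
  | hneg z ih =>
    intro hn h
    have h' : z.im ≠ 0 := by simpa using h
    rw [hv.map_neg hκ (mem_slitDom_of_im_ne h'), Complex.neg_im, abs_neg]
    exact ih (by simpa using hn) h'
  | hconj z ih =>
    intro hn h
    have h' : z.im ≠ 0 := by simpa using h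
    rw [hv.map_conj hκ (mem_slitDom_of_im_ne h'), Complex.conj_im, abs_neg]
    exact ih (by simpa using hn) h'
  | h z hre him =>
    intro hn h
    have h' := lt_of_le_of_ne him h.symm
    rw [abs_of_pos (hv.im_pos_of_quadrant hκ hn.le hre h'), hv.im_of_norm_eq_one hκ hn hre h']

lemma IsVmap.injOn_upper (hv : IsVmap κ v) (hκ : κ ∈ Ioo (0 : ℝ) 1) :
    InjOn v (Metric.ball 0 1 ∩ (slitDom κ ∩ {z | 0 ≤ z.im})) :=
  injOn_of_re_hasDerivAt_pos ((convex_ball 0 1).inter (convex_slitDom_inter_im_nonneg κ))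
    (fun _ hz => hv.hasDerivAt hκ hz.2.1)
    (fun z hz => vDeriv_re_pos hκ z hz.2.1 (mem_ball_zero_iff.1 hz.1).le)

lemma IsVmap.injOn (hv : IsVmap κ v) (hκ : κ ∈ Ioo (0 : ℝ) 1) :
    InjOn v (Metric.ball 0 1 ∩ slitDom κ) := by
  have hsign : ∀ z ∈ Metric.ball (0 : ℂ) 1 ∩ slitDom κ, (0 ≤ z.im ↔ 0 ≤ (v z).im) := by
    rintro z ⟨hz, hzs⟩
    by_cases h : z.im = 0
    · simp [h, hv.im_eq_zero hκ hzs h]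
    · have := hv.im_mul_im_pos hκ z (mem_ball_zero_iff.1 hz).le h
      rcases mul_pos_iff.1 this with h | h
      · exact iff_of_true h.1.le h.2.le
      · exact iff_of_false (not_le.2 h.1) (not_le.2 h.2)
  rintro z ⟨hz, hzs⟩ w ⟨hw, hws⟩ h
  have hiff := (hsign z ⟨hz, hzs⟩).trans (h ▸ (hsign w ⟨hw, hws⟩).symm)
  by_cases h0 : 0 ≤ z.im
  · exact hv.injOn_upper hκ ⟨hz, hzs, h0⟩ ⟨hw, hws, hiff.1 h0⟩ h
  · have h1 : ¬ 0 ≤ w.im := fun h' => h0 (hiff.2 h')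
    refine (starRingEnd ℂ).injective (hv.injOn_upper hκ ⟨?_, conj_mem_slitDom hzs, ?_⟩
      ⟨?_, conj_mem_slitDom hws, ?_⟩ ?_)
    · simpa using hz
    · simpa using (not_le.1 h0).le
    · simpa using hw
    · simpa using (not_le.1 h1).le
    · rw [hv.map_conj hκ hzs, hv.map_conj hκ hws, h]

lemma IsVmap.mapsTo (hv : IsVmap κ v) (hκ : κ ∈ Ioo (0 : ℝ) 1) :
    MapsTo v (Metric.ball 0 1 ∩ slitDom κ) (rectDom (Tell κ)) := by
  rintro z ⟨hz, hzs⟩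
  have hn := mem_ball_zero_iff.1 hz
  exact ⟨abs_lt.1 (hv.abs_re_lt hκ hzs hn.le), abs_lt.1 (hv.abs_im_lt hκ z hzs hn)⟩

lemma IsVmap.isOpen_image (hv : IsVmap κ v) (hκ : κ ∈ Ioo (0 : ℝ) 1) :
    IsOpen (v '' (Metric.ball 0 1 ∩ slitDom κ)) := by
  rw [isOpen_iff_mem_nhds]
  rintro _ ⟨z, hz, rfl⟩
  have h1 : HasStrictDerivAt v (vDeriv κ z) z := by
    have := (hv.analytic z hz.2).hasStrictDerivAt
    rwa [(hv.hasDerivAt hκ hz.2).deriv] at this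
  have h2 : vDeriv κ z ≠ 0 := fun h => by
    have := vDeriv_re_pos hκ z hz.2 (mem_ball_zero_iff.1 hz.1).le
    simp [h] at this
  rw [← h1.map_nhds_eq h2]
  exact Filter.image_mem_map ((Metric.isOpen_ball.inter (isOpen_slitDom κ)).mem_nhds hz)

lemma convex_rectDom (T : ℝ) : Convex ℝ (rectDom T) :=
  ((convex_Ioo _ _).linear_preimage Complex.reLm).inter
    ((convex_Ioo _ _).linear_preimage Complex.imLm)

lemma IsVmap.closure_image_inter_subset (hv : IsVmap κ v) (hκ : κ ∈ Ioo (0 : ℝ) 1) :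
    closure (v '' (Metric.ball 0 1 ∩ slitDom κ)) ∩ rectDom (Tell κ)
      ⊆ v '' (Metric.ball 0 1 ∩ slitDom κ) := by
  rintro y ⟨hy, hyre, hyim⟩
  obtain ⟨x, hx, hxy⟩ := mem_closure_iff_seq_limit.1 hy
  choose u hu hux using hx
  obtain rfl : x = fun n => v (u n) := funext fun n => (hux n).symm
  obtain ⟨z, hz, φ, hφ, hlim⟩ := (isCompact_closedBall (0 : ℂ) 1).tendsto_subseq
    (fun n => Metric.ball_subset_closedBall (hu n).1)
  have hvy := hxy.comp hφ.tendsto_atTop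
  by_cases hzs : z ∈ slitDom κ
  · have hvz : v z = y := tendsto_nhds_unique
      ((hv.hasDerivAt hκ hzs).continuousAt.tendsto.comp hlim) hvy
    rcases (mem_closedBall_zero_iff.1 hz).lt_or_eq with h | h
    · exact ⟨z, ⟨mem_ball_zero_iff.2 h, hzs⟩, hvz⟩
    · have him : z.im ≠ 0 := fun h0 => hzs ⟨h0, by
        have := norm_sq_eq z
        rw [h, h0] at this
        linarith [hκ.2]⟩
      have := hv.abs_im_of_norm_eq_one hκ z h him
      rw [hvz] at this
      exact absurd this (abs_lt.2 hyim).ne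
  · exfalso
    have hlim1 : Filter.Tendsto (fun n => Real.sqrt (confocal κ (u (φ n)))) Filter.atTop
        (nhdsWithin 1 (Icc 0 1)) := by
      refine tendsto_nhdsWithin_iff.2 ⟨?_, Filter.Eventually.of_forall fun n =>
        ⟨Real.sqrt_nonneg _, Real.sqrt_le_one.2 (confocal_lt_one hκ.1 (hu _).2).le⟩⟩
      have := ((Real.continuous_sqrt.comp (continuous_confocal κ)).tendsto z).comp hlim
      rwa [Function.comp_apply, confocal_eq_one hκ.1 hzs, Real.sqrt_one] at this
    have hlim2 := (continuousOn_axisRe hκ 1 (right_mem_Icc.2 zero_le_one)).tendsto.comp hlim1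
    rw [axisRe_one hκ] at hlim2
    have hlim3 := ((Complex.continuous_im.abs.tendsto z).comp hlim).div_const
      (4 * Kell κ * κ * (1 - κ) ^ 2)
    rw [(not_not.1 hzs).1, abs_zero, zero_div] at hlim3
    have hle := le_of_tendsto_of_tendsto' (hlim2.sub hlim3)
      ((Complex.continuous_re.abs.tendsto y).comp hvy) fun n =>
        (hv.abs_re_mem hκ _ (hu (φ n)).2 (mem_ball_zero_iff.1 (hu (φ n)).1).le).1
    rw [sub_zero] at hle
    exact absurd (abs_lt.2 hyre) (not_lt.2 hle)

theorem IsVmap.bijOn (hv : IsVmap κ v) (hκ : κ ∈ Ioo (0 : ℝ) 1) :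
    BijOn v (Metric.ball 0 1 ∩ slitDom κ) (rectDom (Tell κ)) := by
  refine ⟨hv.mapsTo hκ, hv.injOn hκ, ?_⟩
  refine (convex_rectDom _).isPreconnected.subset_of_closure_inter_subset (hv.isOpen_image hκ) ?_
    (hv.closure_image_inter_subset hκ)
  have h0 : (0 : ℂ) ∈ Metric.ball (0 : ℂ) 1 ∩ slitDom κ :=
    ⟨by simp, zero_mem_slitDom hκ.1⟩
  exact ⟨v 0, hv.mapsTo hκ h0, mem_image_of_mem v h0⟩

end VMap

section Psi

variable {k : ℝ}

lemma one_sub_mem_slitPlane (hk : k ∈ Ioo (0 : ℝ) 1) {z : ℂ} (hz : z ∈ slitDom 1) :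
    1 - (k : ℂ) * z ^ 2 ∈ slitPlane := by
  have := sub_sq_mem_slitPlane one_pos hk.1
    (slitDom_mono ((one_le_div hk.1).2 hk.2.le) hz)
  rwa [Complex.ofReal_one] at this

lemma ball_subset_slitDom_one : Metric.ball (0 : ℂ) 1 ⊆ slitDom 1 := by
  rintro z hz ⟨h1, h2⟩
  have h3 := norm_sq_eq z
  have h4 : ‖z‖ ^ 2 < 1 := pow_lt_one₀ (norm_nonneg _) (mem_ball_zero_iff.1 hz) two_ne_zero
  rw [h1] at h3
  linarith

lemma one_add_csqrt_ne_zero {a : ℂ} (ha : a ∈ slitPlane) : 1 + Complex.sqrt a ≠ 0 := fun h => by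
  have h1 := csqrt_re_pos ha
  have h2 := congrArg Complex.re h
  rw [Complex.add_re, Complex.one_re, Complex.zero_re] at h2
  linarith

lemma psiK_eq (hk : k ∈ Ioo (0 : ℝ) 1) {z : ℂ} (hz : z ∈ slitDom 1) :
    psiK k z = Real.sqrt k * z / (1 + Complex.sqrt (1 - k * z ^ 2)) := by
  have h1 := one_add_csqrt_ne_zero (one_sub_mem_slitPlane hk hz)
  have h2 := csqrt_sq (1 - (k : ℂ) * z ^ 2)
  have h3 : (Real.sqrt k : ℂ) ^ 2 = k := by exact_mod_cast Real.sq_sqrt hk.1.le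
  have h4 : (Real.sqrt k : ℂ) ≠ 0 := by exact_mod_cast (Real.sqrt_pos.2 hk.1).ne'
  rw [psiK, one_div]
  split_ifs with h0
  · simp [h0]
  · change (1 - Complex.sqrt (1 - (k : ℂ) * z ^ 2)) / (Real.sqrt k * z) = _
    rw [div_eq_div_iff (mul_ne_zero h4 h0) h1]
    linear_combination -h2 - z ^ 2 * h3

lemma psiK_sq (hk : k ∈ Ioo (0 : ℝ) 1) {z : ℂ} (hz : z ∈ slitDom 1) :
    psiK k z ^ 2
      = (1 - Complex.sqrt (1 - k * z ^ 2)) / (1 + Complex.sqrt (1 - k * z ^ 2)) := by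
  have h1 := one_add_csqrt_ne_zero (one_sub_mem_slitPlane hk hz)
  have h2 := csqrt_sq (1 - (k : ℂ) * z ^ 2)
  have h3 : (Real.sqrt k : ℂ) ^ 2 = k := by exact_mod_cast Real.sq_sqrt hk.1.le
  rw [psiK_eq hk hz, div_pow, div_eq_div_iff (pow_ne_zero 2 h1) h1]
  linear_combination (1 + Complex.sqrt (1 - k * z ^ 2)) * (h2 + z ^ 2 * h3)

lemma one_add_psiK_sq (hk : k ∈ Ioo (0 : ℝ) 1) {z : ℂ} (hz : z ∈ slitDom 1) :
    1 + psiK k z ^ 2 = 2 / (1 + Complex.sqrt (1 - k * z ^ 2)) := by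
  have h1 := one_add_csqrt_ne_zero (one_sub_mem_slitPlane hk hz)
  rw [psiK_sq hk hz]
  field_simp
  ring

lemma sqrt_mul_one_add_psiK_sq (hk : k ∈ Ioo (0 : ℝ) 1) {z : ℂ} (hz : z ∈ slitDom 1) :
    Real.sqrt k * z * (1 + psiK k z ^ 2) = 2 * psiK k z := by
  rw [one_add_psiK_sq hk hz, psiK_eq hk hz]
  ring

lemma norm_psiK_lt_one (hk : k ∈ Ioo (0 : ℝ) 1) {z : ℂ} (hz : z ∈ slitDom 1) :
    ‖psiK k z‖ < 1 := by
  have h1 := one_add_csqrt_ne_zero (one_sub_mem_slitPlane hk hz)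
  have h2 := csqrt_re_pos (one_sub_mem_slitPlane hk hz)
  refine lt_of_pow_lt_pow_left₀ 2 zero_le_one ?_
  rw [← norm_pow, psiK_sq hk hz, norm_div, one_pow, div_lt_one (norm_pos_iff.2 h1)]
  refine lt_of_pow_lt_pow_left₀ 2 (norm_nonneg _) ?_
  rw [norm_sq_eq, norm_sq_eq]
  simp only [Complex.sub_re, Complex.add_re, Complex.one_re, Complex.sub_im, Complex.add_im,
    Complex.one_im]
  nlinarith

lemma psiK_injOn (hk : k ∈ Ioo (0 : ℝ) 1) : InjOn (psiK k) (slitDom 1) := by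
  intro z hz w hw h
  have h1 := sqrt_mul_one_add_psiK_sq hk hz
  rw [h, ← sqrt_mul_one_add_psiK_sq hk hw] at h1
  have h2 : 1 + psiK k w ^ 2 ≠ 0 := by
    rw [one_add_psiK_sq hk hw]
    exact div_ne_zero two_ne_zero (one_add_csqrt_ne_zero (one_sub_mem_slitPlane hk hw))
  have h4 : (Real.sqrt k : ℂ) ≠ 0 := by exact_mod_cast (Real.sqrt_pos.2 hk.1).ne'
  exact mul_left_cancel₀ h4 (mul_right_cancel₀ h2 h1)

lemma analyticOnNhd_psiK (hk : k ∈ Ioo (0 : ℝ) 1) : AnalyticOnNhd ℂ (psiK k) (slitDom 1) := by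
  have h : AnalyticOnNhd ℂ
      (fun z => Real.sqrt k * z / (1 + Complex.sqrt (1 - k * z ^ 2))) (slitDom 1) := by
    intro z hz
    have hs := one_sub_mem_slitPlane hk hz
    exact (analyticAt_const.mul analyticAt_id).div
      (analyticAt_const.add (analyticAt_csqrt (by fun_prop) hs)) (one_add_csqrt_ne_zero hs)
  exact h.congr (isOpen_slitDom 1) fun z hz => (psiK_eq hk hz).symm

lemma hasDerivAt_psiK (hk : k ∈ Ioo (0 : ℝ) 1) {z : ℂ} (hz : z ∈ slitDom 1) :
    HasDerivAt (psiK k) (Real.sqrt k / (Complex.sqrt (1 - k * z ^ 2) *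
      (1 + Complex.sqrt (1 - k * z ^ 2)))) z := by
  have hs := one_sub_mem_slitPlane hk hz
  have h1 := one_add_csqrt_ne_zero hs
  have h0 := csqrt_ne_zero hs
  have hd : HasDerivAt (fun z : ℂ => Complex.sqrt (1 - (k : ℂ) * z ^ 2)) _ z :=
    (analyticAt_csqrt (f := fun z => 1 - (k : ℂ) * z ^ 2)
      (by fun_prop) hs).differentiableAt.hasDerivAt
  set s' := deriv (fun z : ℂ => Complex.sqrt (1 - (k : ℂ) * z ^ 2)) z
  have hd2 := hd.pow 2
  have e : (fun z : ℂ => Complex.sqrt (1 - (k : ℂ) * z ^ 2)) ^ 2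
      = fun z : ℂ => 1 - (k : ℂ) * z ^ 2 := funext fun z => csqrt_sq _
  rw [e] at hd2
  have hs' := hd2.unique (((hasDerivAt_pow 2 z).const_mul (k : ℂ)).const_sub 1)
  have hmain := ((hasDerivAt_id z).const_mul (Real.sqrt k : ℂ)).div (hd.const_add 1) h1
  refine (hmain.congr_of_eventuallyEq ?_).congr_deriv ?_
  · filter_upwards [(isOpen_slitDom 1).mem_nhds hz] with w hw
    exact psiK_eq hk hw
  · have h2 := csqrt_sq (1 - (k : ℂ) * z ^ 2)
    rw [div_eq_div_iff (pow_ne_zero 2 h1) (mul_ne_zero h0 h1)]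
    simp only [id, Nat.add_one_sub_one, pow_one, Nat.cast_ofNat] at hs' ⊢
    linear_combination Real.sqrt k * (1 + Complex.sqrt (1 - (k : ℂ) * z ^ 2)) * (h2 - z / 2 * hs')

lemma psiK_ofReal (hk : k ∈ Ioo (0 : ℝ) 1) {x : ℝ} (hx : x ^ 2 < 1) :
    psiK k x = ((Real.sqrt k * x / (1 + Real.sqrt (1 - k * x ^ 2)) : ℝ) : ℂ) := by
  have h : 0 < 1 - k * x ^ 2 := by nlinarith [hk.1, hk.2, sq_nonneg x]
  have e : 1 - (k : ℂ) * (x : ℂ) ^ 2 = ((1 - k * x ^ 2 : ℝ) : ℂ) := by push_cast; ring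
  rw [psiK_eq hk (ofReal_mem_slitDom.2 hx), e, csqrt_ofReal h]
  push_cast
  rfl

lemma psiK_ofReal_sq (hk : k ∈ Ioo (0 : ℝ) 1) {x : ℝ} (hx : x ^ 2 < 1) :
    (Real.sqrt k * x / (1 + Real.sqrt (1 - k * x ^ 2))) ^ 2
      = (1 - Real.sqrt (1 - k * x ^ 2)) / (1 + Real.sqrt (1 - k * x ^ 2)) := by
  have h : 0 < 1 - k * x ^ 2 := by nlinarith [hk.1, hk.2, sq_nonneg x]
  have hs := Real.sqrt_pos.2 h
  rw [div_pow, mul_pow, Real.sq_sqrt hk.1.le, div_eq_div_iff (by positivity) (by positivity)]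
  linear_combination (1 + Real.sqrt (1 - k * x ^ 2)) * Real.sq_sqrt h.le

lemma psiK_mem_slitDom_iff (hk : k ∈ Ioo (0 : ℝ) 1) {z : ℂ} (hz : z ∈ slitDom 1) :
    psiK k z ∈ slitDom (kLanden k) ↔ z ∈ slitDom k := by
  have hk0 := hk.1
  have hκ1 := one_add_kLanden hk
  have hκ2 := one_sub_kLanden hk
  have hκ := (kLanden_mem hk).1
  have hc := (kComp_mem hk).1
  have key : ∀ x : ℝ, x ^ 2 < 1 → (psiK k x ∈ slitDom (kLanden k) ↔ (x : ℂ) ∈ slitDom k) := by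
    intro x hx
    have h : 0 < 1 - k * x ^ 2 := by nlinarith [hk.1, hk.2, sq_nonneg x]
    have hs := Real.sqrt_pos.2 h
    rw [psiK_ofReal hk hx, ofReal_mem_slitDom, ofReal_mem_slitDom, psiK_ofReal_sq hk hx,
      div_lt_iff₀ (by positivity)]
    have h1 : kComp k < Real.sqrt (1 - k * x ^ 2) ↔ x ^ 2 < k := by
      rw [Real.lt_sqrt hc.le, kComp_sq hk, sub_lt_sub_iff_left, pow_two k]
      exact mul_lt_mul_iff_right₀ hk0
    rw [← h1]
    constructor <;> intro h2 <;> nlinarith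
  by_cases him : z.im = 0
  · have e : z = (z.re : ℂ) := Complex.ext rfl (by simpa using him)
    rw [e]
    exact key _ (not_le.1 fun h => hz ⟨him, h⟩)
  · refine iff_of_true (mem_slitDom_of_im_ne fun h => him ?_) (mem_slitDom_of_im_ne him)
    have e : psiK k z = ((psiK k z).re : ℂ) := Complex.ext rfl (by simpa using h)
    have h1 := sqrt_mul_one_add_psiK_sq hk hz
    rw [e] at h1
    have h2 := congrArg Complex.im h1
    have h3 : Real.sqrt k * z * (1 + ((psiK k z).re : ℂ) ^ 2)
        = ((Real.sqrt k * (1 + (psiK k z).re ^ 2) : ℝ) : ℂ) * z := by push_cast; ring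
    have h4 : (2 * ((psiK k z).re : ℂ)) = ((2 * (psiK k z).re : ℝ) : ℂ) := by push_cast; ring
    rw [h3, h4, Complex.im_ofReal_mul, Complex.ofReal_im] at h2
    have := Real.sqrt_pos.2 hk0
    exact (mul_eq_zero.1 h2).resolve_left (by positivity)

lemma psiK_image_ball_inter (hk : k ∈ Ioo (0 : ℝ) 1) :
    psiK k '' Metric.ball 0 1 ∩ slitDom (kLanden k)
      = psiK k '' (Metric.ball 0 1 ∩ slitDom k) := by
  ext w
  constructor
  · rintro ⟨⟨z, hz, rfl⟩, hw⟩
    exact ⟨z, ⟨hz, (psiK_mem_slitDom_iff hk (ball_subset_slitDom_one hz)).1 hw⟩, rfl⟩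
  · rintro ⟨z, ⟨hz, hzs⟩, rfl⟩
    exact ⟨⟨z, hz, rfl⟩, (psiK_mem_slitDom_iff hk (ball_subset_slitDom_one hz)).2 hzs⟩

/-- Landen's transformation: `v_{k₁} ∘ ψ_k = v_k`. -/
lemma IsVmap.comp_psiK {v : ℂ → ℂ} (hk : k ∈ Ioo (0 : ℝ) 1) (hv : IsVmap (kLanden k) v) :
    IsVmap k (v ∘ psiK k) where
  map_zero := by simp [psiK, hv.map_zero]
  analytic z hz := by
    have hz1 := slitDom_mono hk.2.le hz
    exact (hv.analytic _ ((psiK_mem_slitDom_iff hk hz1).2 hz)).comp (analyticOnNhd_psiK hk z hz1)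
  deriv_real x hx := by
    have hk0 := hk.1
    have hx1 : x ^ 2 < 1 := hx.trans hk.2
    have hxs : (x : ℂ) ∈ slitDom 1 := ofReal_mem_slitDom.2 hx1
    have h : 0 < 1 - k * x ^ 2 := by nlinarith [hk.1, hk.2, sq_nonneg x]
    have hs := Real.sqrt_pos.2 h
    have hψ := psiK_ofReal hk hx1
    have hψ2 := psiK_ofReal_sq hk hx1
    have e : 1 - (k : ℂ) * (x : ℂ) ^ 2 = ((1 - k * x ^ 2 : ℝ) : ℂ) := by push_cast; ring
    have hd := hasDerivAt_psiK hk hxs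
    rw [e, csqrt_ofReal h] at hd
    have hs2 := Real.sq_sqrt h.le
    set s := Real.sqrt (1 - k * x ^ 2) with hsdef
    set w := Real.sqrt k * x / (1 + s) with hw
    have hwκ : w ^ 2 < kLanden k := by
      rw [← ofReal_mem_slitDom, ← hψ]
      exact (psiK_mem_slitDom_iff hk hxs).2 (ofReal_mem_slitDom.2 hx)
    have hv' := hv.deriv_real w hwκ
    rw [← hψ] at hv'
    refine (hv'.comp (x : ℂ) hd).congr_deriv ?_
    obtain ⟨hκ0, hκ1⟩ := kLanden_mem hk
    have hK := Kell_pos (kLanden_mem hk)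
    have hid : (1 + kLanden k) ^ 2 * (k * (k - x ^ 2))
        = (1 + s) ^ 2 * ((kLanden k - w ^ 2) * (1 - kLanden k * w ^ 2)) := by
      rw [hψ2]
      field_simp
      linear_combination (-(1 + kLanden k) ^ 2) * hs2 + (1 + kLanden k) ^ 2 * kComp_sq hk
        + (1 - kLanden k + (1 + kLanden k) * kComp k) * one_sub_kLanden hk
    have hroot := congrArg Real.sqrt hid
    rw [Real.sqrt_mul (sq_nonneg _), Real.sqrt_mul (sq_nonneg _), Real.sqrt_sq (by positivity),
      Real.sqrt_sq (by positivity), Real.sqrt_mul hk0.le] at hroot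
    have hpos : 0 < Real.sqrt ((kLanden k - w ^ 2) * (1 - kLanden k * w ^ 2)) :=
      Real.sqrt_pos.2 (mul_pos (sub_pos.2 hwκ) (by nlinarith [sq_nonneg w]))
    have hpos' := Real.sqrt_pos.2 (sub_pos.2 hx)
    rw [Kell_landen hk, Real.sqrt_mul (sub_pos.2 hx).le, ← hsdef]
    norm_cast
    rw [div_mul_div_comm, div_eq_div_iff (by positivity) (by positivity)]
    linear_combination 4 * Kell (kLanden k) * s * hroot

end Psi

/-- Lemma 3 (mapping lemma): `ψ_k` maps `𝔻` biholomorphically into `𝔻`, `T_{k₁} = 2T_k`,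
and `v_{k₁}` maps `𝔻 ∖ {z ∈ ℝ : z² ≥ k₁}` (resp. `ψ_k(𝔻) ∖ {z ∈ ℝ : z² ≥ k₁}`)
biholomorphically onto the open rectangle of width `1/2` and height `T_{k₁}` (resp. `T_k`). -/
theorem statement3 (k : ℝ) (hk : k ∈ Set.Ioo (0 : ℝ) 1)
    (v : ℂ → ℂ) (hv : IsVmap (kLanden k) v) :
    (AnalyticOnNhd ℂ (psiK k) (Metric.ball (0 : ℂ) 1) ∧
      Set.InjOn (psiK k) (Metric.ball (0 : ℂ) 1) ∧
      psiK k '' Metric.ball (0 : ℂ) 1 ⊆ Metric.ball (0 : ℂ) 1) ∧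
    Tell (kLanden k) = 2 * Tell k ∧
    Set.BijOn v (Metric.ball (0 : ℂ) 1 ∩ slitDom (kLanden k)) (rectDom (Tell (kLanden k))) ∧
    Set.BijOn v ((psiK k '' Metric.ball (0 : ℂ) 1) ∩ slitDom (kLanden k))
      (rectDom (Tell k)) := by
  refine ⟨⟨(analyticOnNhd_psiK hk).mono ball_subset_slitDom_one,
    (psiK_injOn hk).mono ball_subset_slitDom_one, ?_⟩, Tell_landen hk,
    hv.bijOn (kLanden_mem hk), ?_⟩
  · rintro _ ⟨z, hz, rfl⟩
    exact mem_ball_zero_iff.2 (norm_psiK_lt_one hk (ball_subset_slitDom_one hz))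
  · rw [psiK_image_ball_inter hk, ← bijOn_comp_iff
      ((psiK_injOn hk).mono (inter_subset_left.trans ball_subset_slitDom_one))]
    exact (hv.comp_psiK hk).bijOn hk

end
end
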